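/- arXiv:1403.3042 — 4 statements merged into one kernel-verified Lean document; each statement's English description precedes it below -/
import Mathlib

section
/- Let R be a Noetherian Frobenius ring and R-Mod the stable module category model structure on the category of R-modules, in which the cofibrations are the monomorphisms, the fibrations are the epimorphisms and the weak equivalences are the stable equivalences. Then the full subcategory W_st of the arrow category (R-Mod)^→ spanned by the stable equivalences is finitely accessible: it is closed under filtered colimits in (R-Mod)^→ and every stable equivalence is a filtered colimit in (R-Mod)^→ of stable equivalences between finitely presentable R-modules. -/
open CategoryTheory CategoryTheory.Limits

universe w v u

namespace PaperAcc

/-- A category `J` is `κ`-filtered if every diagram indexed by a category with fewer than `κ`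
arrows admits a cocone. -/
def IsCardinalFiltered (J : Type v) [Category.{v} J] (κ : Cardinal.{v}) : Prop :=
  ∀ (A : Type v) [SmallCategory A], Cardinal.mk (Arrow A) < κ →
    ∀ F : A ⥤ J, Nonempty (Cocone F)

/-- A preorder `P` is `κ`-directed if every subset of cardinality `< κ` has an upper bound. -/
def IsCardinalDirected (P : Type v) [Preorder P] (κ : Cardinal.{v}) : Prop :=
  ∀ S : Set P, Cardinal.mk S < κ → ∃ p : P, ∀ s ∈ S, s ≤ p

/-- An object `X` is `κ`-presentable if `Hom(X, -)` preserves `κ`-filtered colimits. -/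
def IsPresentable {M : Type u} [Category.{v} M] (κ : Cardinal.{v}) (X : M) : Prop :=
  ∀ (J : Type v) [SmallCategory J], IsCardinalFiltered J κ →
    Nonempty (PreservesColimitsOfShape J (coyoneda.obj (Opposite.op X)))

/-- A presentation of `X` as a `κ`-filtered colimit of objects belonging to `P`. -/
structure FilteredColimitPresentation {M : Type u} [Category.{v} M] (κ : Cardinal.{v})
    (P : Set M) (X : M) where
  J : Type v
  [instJ : SmallCategory J]
  filtered : IsCardinalFiltered J κ
  F : J ⥤ M
  mem : ∀ j, F.obj j ∈ P
  c : Cocone F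
  isColimit : IsColimit c
  iso : c.pt ≅ X

/-- A presentation of `X` as a `κ`-directed colimit of objects belonging to `P`. -/
structure DirectedColimitPresentation {M : Type u} [Category.{v} M] (κ : Cardinal.{v})
    (P : Set M) (X : M) where
  J : Type v
  [instJ : Preorder J]
  directed : IsCardinalDirected J κ
  F : J ⥤ M
  mem : ∀ j, F.obj j ∈ P
  c : Cocone F
  isColimit : IsColimit c
  iso : c.pt ≅ X

/-- A class of arrows (viewed as a full subcategory of the arrow category) is closed under
`κ`-filtered colimits. -/
def ClosedUnderFilteredColimits {M : Type u} [Category.{v} M] (κ : Cardinal.{v})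
    (P : Set (Arrow M)) : Prop :=
  ∀ (J : Type v) [SmallCategory J], IsCardinalFiltered J κ →
    ∀ (F : J ⥤ Arrow M) (c : Cocone F), IsColimit c → (∀ j, F.obj j ∈ P) → c.pt ∈ P

/-- The morphisms having the right lifting property with respect to every member of the
family `f`. -/
def RlpOf {M : Type u} [Category.{v} M] {ι : Type w} {A B : ι → M}
    (f : ∀ i, A i ⟶ B i) : MorphismProperty M :=
  fun _ _ g => ∀ i, HasLiftingProperty (f i) g

/-- The morphisms having the left lifting property with respect to every morphism in `P`. -/
def Llp {M : Type u} [Category.{v} M] (P : MorphismProperty M) : MorphismProperty M :=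
  fun _ _ g => ∀ ⦃X Y : M⦄ (p : X ⟶ Y), P p → HasLiftingProperty g p

/-- The class `C` is cofibrantly generated by a set of morphisms between `κ`-presentable
objects: `C = llp(rlp(I))` for such a set `I`. -/
def CofibrantlyGeneratedByPresentables {M : Type u} [Category.{v} M] (κ : Cardinal.{v})
    (C : MorphismProperty M) : Prop :=
  ∃ (ι : Type v) (A B : ι → M) (f : ∀ i, A i ⟶ B i),
    (∀ i, IsPresentable κ (A i)) ∧ (∀ i, IsPresentable κ (B i)) ∧
      C = Llp (RlpOf f)

/-- A category is locally `κ`-presentable: it is cocomplete and has a set of `κ`-presentable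
objects such that every object is a `κ`-filtered colimit of objects from this set. -/
def IsLocallyPresentable (M : Type u) [Category.{v} M] (κ : Cardinal.{v}) : Prop :=
  HasColimits M ∧
    ∃ (ι : Type v) (G : ι → M), (∀ i, IsPresentable κ (G i)) ∧
      ∀ X : M, Nonempty (FilteredColimitPresentation κ (Set.range G) X)

/-- A class of morphisms is stable under retracts (in the arrow category). -/
def IsStableUnderRetracts {M : Type u} [Category.{v} M] (P : MorphismProperty M) : Prop :=
  ∀ {X Y X' Y' : M} (f : X ⟶ Y) (g : X' ⟶ Y') (iX : X ⟶ X') (rX : X' ⟶ X)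
    (iY : Y ⟶ Y') (rY : Y' ⟶ Y), iX ≫ rX = 𝟙 X → iY ≫ rY = 𝟙 Y →
    iX ≫ g = f ≫ iY → rX ≫ f = g ≫ rY → P g → P f

/-- A model structure on a category: classes of weak equivalences, cofibrations and fibrations
satisfying the axioms of a (closed) model category. -/
structure ModelStructure (M : Type u) [Category.{v} M] where
  W : MorphismProperty M
  Cof : MorphismProperty M
  Fib : MorphismProperty M
  W_id : ∀ X : M, W (𝟙 X)
  W_comp : ∀ {X Y Z : M} (f : X ⟶ Y) (g : Y ⟶ Z), W f → W g → W (f ≫ g)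
  W_of_comp_right : ∀ {X Y Z : M} (f : X ⟶ Y) (g : Y ⟶ Z), W g → W (f ≫ g) → W f
  W_of_comp_left : ∀ {X Y Z : M} (f : X ⟶ Y) (g : Y ⟶ Z), W f → W (f ≫ g) → W g
  W_retract : IsStableUnderRetracts W
  Cof_retract : IsStableUnderRetracts Cof
  Fib_retract : IsStableUnderRetracts Fib
  lift_trivCof_fib : ∀ {A B X Y : M} (i : A ⟶ B) (p : X ⟶ Y),
    Cof i → W i → Fib p → HasLiftingProperty i p
  lift_cof_trivFib : ∀ {A B X Y : M} (i : A ⟶ B) (p : X ⟶ Y),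
    Cof i → Fib p → W p → HasLiftingProperty i p
  fact_cof_trivFib : ∀ {X Y : M} (f : X ⟶ Y),
    ∃ (Z : M) (i : X ⟶ Z) (p : Z ⟶ Y), Cof i ∧ Fib p ∧ W p ∧ i ≫ p = f
  fact_trivCof_fib : ∀ {X Y : M} (f : X ⟶ Y),
    ∃ (Z : M) (i : X ⟶ Z) (p : Z ⟶ Y), Cof i ∧ W i ∧ Fib p ∧ i ≫ p = f

/-- A model structure is `κ`-combinatorial if the underlying category is locally
`κ`-presentable and both cofibrations and trivial cofibrations are cofibrantly generated
by sets of morphisms between `κ`-presentable objects. -/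
structure IsCombinatorial {M : Type u} [Category.{v} M] (S : ModelStructure M)
    (κ : Cardinal.{v}) : Prop where
  isRegular : κ.IsRegular
  locallyPresentable : IsLocallyPresentable M κ
  cofGenerated : CofibrantlyGeneratedByPresentables κ S.Cof
  trivCofGenerated : CofibrantlyGeneratedByPresentables κ (S.Cof ⊓ S.W)

/-- An object is cofibrant if the morphism from an(y) initial object to it is a cofibration. -/
def Cofibrant {M : Type u} [Category.{v} M] (S : ModelStructure M) (X : M) : Prop :=
  ∀ ⦃O : M⦄, IsInitial O → ∀ f : O ⟶ X, S.Cof f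

/-- A cylinder object for `X`: a factorization `X ⊔ X → C → X` of the codiagonal into
a cofibration followed by a weak equivalence. -/
structure CylinderObject {M : Type u} [Category.{v} M] (S : ModelStructure M) (X : M) where
  C : M
  i₀ : X ⟶ C
  i₁ : X ⟶ C
  p : C ⟶ X
  hi₀ : i₀ ≫ p = 𝟙 X
  hi₁ : i₁ ≫ p = 𝟙 X
  hp : S.W p
  hcof : ∀ (c : BinaryCofan X X) (hc : IsColimit c), S.Cof (hc.desc (BinaryCofan.mk i₀ i₁))

/-- A commutative square on `(f, g, h, k)` (with `f : A ⟶ B`, `g : A ⟶ X`, `h : B ⟶ Y`,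
`k : X ⟶ Y`) is a homotopy pushout: for some (equivalently, any) replacement of the span
`B ← A → X` by a span of cofibrations between cofibrant objects which is weakly equivalent
to it, the comparison morphism from the (strict) pushout of the replacement to `Y` is a
weak equivalence. -/
def IsHomotopyPushout {M : Type u} [Category.{v} M] (S : ModelStructure M)
    {A B X Y : M} (f : A ⟶ B) (g : A ⟶ X) (h : B ⟶ Y) (k : X ⟶ Y) : Prop :=
  ∃ (A' B' X' P : M) (wA : A' ⟶ A) (i : A' ⟶ B') (wB : B' ⟶ B)
    (j : A' ⟶ X') (wX : X' ⟶ X) (pB : B' ⟶ P) (pX : X' ⟶ P) (m : P ⟶ Y),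
      Cofibrant S A' ∧ S.W wA ∧ S.Cof i ∧ S.W wB ∧ S.Cof j ∧ S.W wX ∧
      i ≫ wB = wA ≫ f ∧ j ≫ wX = wA ≫ g ∧
      IsPushout i j pB pX ∧ pB ≫ m = wB ≫ h ∧ pX ≫ m = wX ≫ k ∧ S.W m

/-- A morphism `i : A ⟶ B` is a formal cofibration if every pushout square of `i` along a
morphism `f : A ⟶ X` with `X` cofibrant is a homotopy pushout. -/
def IsFormalCofibration {M : Type u} [Category.{v} M] (S : ModelStructure M)
    {A B : M} (i : A ⟶ B) : Prop :=
  ∀ {X Y : M} (f : A ⟶ X) (g : B ⟶ Y) (k : X ⟶ Y),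
    Cofibrant S X → IsPushout i f g k → IsHomotopyPushout S i f g k

/-- The set of arrows satisfying `P` whose domain and codomain are `κ`-presentable. -/
def PresentableArrowsIn {M : Type u} [Category.{v} M] (κ : Cardinal.{v})
    (P : Set (Arrow M)) : Set (Arrow M) :=
  {a | a ∈ P ∧ IsPresentable κ a.left ∧ IsPresentable κ a.right}

end PaperAcc

namespace PaperAcc

/-- A morphism of `R`-modules factors through a projective module. -/
def FactorsThroughProjective {R : Type u} [Ring R] {A B : ModuleCat.{u} R} (f : A ⟶ B) :
    Prop :=
  ∃ (P : ModuleCat.{u} R) (g : A ⟶ P) (h : P ⟶ B), Projective P ∧ f = g ≫ h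

/-- A stable equivalence of `R`-modules: a morphism which becomes an isomorphism in the
stable module category (where morphisms factoring through a projective module are identified
with zero). -/
def IsStableEquivalence {R : Type u} [Ring R] {A B : ModuleCat.{u} R} (f : A ⟶ B) : Prop :=
  ∃ g : B ⟶ A,
    FactorsThroughProjective (f ≫ g - 𝟙 A) ∧ FactorsThroughProjective (g ≫ f - 𝟙 B)

section Filtered

variable {J : Type u} [SmallCategory J]

lemma IsCardinalFiltered.isFiltered (h : IsCardinalFiltered J Cardinal.aleph0) :
    IsFiltered J :=
  IsFiltered.of_cocone_nonempty.{u} J fun {A} _ _ F ↦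
    h A (Cardinal.lt_aleph0_iff_finite.2 (Finite.of_equiv _ (Arrow.equivSigma A).symm)) F

lemma isCardinalFiltered_aleph0 [IsFiltered J] :
    IsCardinalFiltered J Cardinal.aleph0 := by
  intro A _ hA F
  have hfin : Finite (Arrow A) := Cardinal.lt_aleph0_iff_finite.1 hA
  have hobj : Finite A := Finite.of_injective (fun a : A ↦ Arrow.mk (𝟙 a))
    fun a b h ↦ congrArg Comma.left h
  have hhom : ∀ a b : A, Finite (a ⟶ b) := fun a b ↦
    Finite.of_injective (fun f : a ⟶ b ↦ Arrow.mk f) fun f g h ↦ Arrow.mk_injective a b h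
  have : FinCategory A :=
    { fintypeObj := Fintype.ofFinite A
      fintypeHom := fun a b ↦ Fintype.ofFinite (a ⟶ b) }
  exact IsFiltered.cocone_nonempty F

end Filtered

section Presentable

variable {R : Type u} [Ring R] {J : Type u} [SmallCategory J] [IsFiltered J]
  {F : J ⥤ ModuleCat.{u} R} {c : Cocone F}

/-- Two morphisms from a finite module to a stage of a filtered diagram which agree in the
colimit agree at a later stage. -/
lemma exists_comp_map_eq (hc : IsColimit c) {M : ModuleCat.{u} R} [Module.Finite R M] {j : J}
    (φ ψ : M ⟶ F.obj j) (h : φ ≫ c.ι.app j = ψ ≫ c.ι.app j) :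
    ∃ (k : J) (u : j ⟶ k), φ ≫ F.map u = ψ ≫ F.map u := by
  classical
  have key : ∀ s : Finset M, ∃ (k : J) (u : j ⟶ k), ∀ x ∈ s,
      (φ ≫ F.map u) x = (ψ ≫ F.map u) x := by
    intro s
    induction s using Finset.induction_on with
    | empty => exact ⟨j, 𝟙 j, by simp⟩
    | insert x s _ ih =>
      obtain ⟨k, u, hu⟩ := ih
      obtain ⟨l, v, w, hvw⟩ := Concrete.isColimit_exists_of_rep_eq F hc (φ x) (ψ x)
        (by simpa using ConcreteCategory.congr_hom h x)
      obtain ⟨m, p, q, hpq⟩ := IsFiltered.bowtie v u w u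
      refine ⟨m, u ≫ q, fun y hy ↦ ?_⟩
      rcases Finset.mem_insert.1 hy with rfl | hy
      · have h₁ : F.map p (F.map v (φ y)) = F.map q (F.map u (φ y)) := by
          simp only [← ConcreteCategory.comp_apply, Category.assoc, ← Functor.map_comp, hpq.1]
        have h₂ : F.map p (F.map w (ψ y)) = F.map q (F.map u (ψ y)) := by
          simp only [← ConcreteCategory.comp_apply, Category.assoc, ← Functor.map_comp, hpq.2]
        have h₃ := h₁.symm.trans ((congrArg (F.map p) hvw).trans h₂)
        simpa using h₃
      · have := congrArg (F.map q) (hu y hy)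
        simpa using this
  obtain ⟨s, hs⟩ := Module.Finite.fg_top (R := R) (M := M)
  obtain ⟨k, u, hu⟩ := key s
  refine ⟨k, u, ModuleCat.hom_ext (LinearMap.ext_on hs fun x hx ↦ hu x hx)⟩

/-- A morphism from a finitely presented module to a filtered colimit factors through a stage. -/
lemma exists_comp_ι_eq (hc : IsColimit c) {M : ModuleCat.{u} R} [Module.FinitePresentation R M]
    (φ : M ⟶ c.pt) : ∃ (j : J) (ψ : M ⟶ F.obj j), ψ ≫ c.ι.app j = φ := by
  classical
  obtain ⟨n, K, e, hK⟩ := Module.FinitePresentation.exists_fin R M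
  let π : (Fin n → R) →ₗ[R] M := e.symm.toLinearMap ∘ₗ K.mkQ
  choose J₀ y₀ hy₀ using fun i ↦
    Concrete.isColimit_exists_rep F hc (φ (π (Pi.basisFun R (Fin n) i)))
  obtain ⟨j, hj⟩ := IsFiltered.sup_objs_exists (Finset.univ.image J₀)
  let g : ∀ i, J₀ i ⟶ j := fun i ↦ (hj (Finset.mem_image_of_mem J₀ (Finset.mem_univ i))).some
  let θ : (Fin n → R) →ₗ[R] F.obj j :=
    (Pi.basisFun R (Fin n)).constr ℕ fun i ↦ F.map (g i) (y₀ i)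
  have hθ : (c.ι.app j).hom ∘ₗ θ = φ.hom ∘ₗ π := by
    refine (Pi.basisFun R (Fin n)).ext fun i ↦ ?_
    have h : c.ι.app j (F.map (g i) (y₀ i)) = c.ι.app (J₀ i) (y₀ i) := by
      rw [← ConcreteCategory.comp_apply, c.w]
    simpa only [LinearMap.comp_apply, θ, Module.Basis.constr_basis] using h.trans (hy₀ i)
  have : Module.Finite R (ModuleCat.of R K) := Module.Finite.iff_fg.2 hK
  obtain ⟨k, u, hu⟩ := exists_comp_map_eq hc (M := ModuleCat.of R K)
    (ModuleCat.ofHom (θ ∘ₗ K.subtype)) 0 (by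
      ext x
      have h : π (x : Fin n → R) = 0 := by
        simp [π, (Submodule.Quotient.mk_eq_zero K).2 x.2]
      simpa [h] using LinearMap.congr_fun hθ (x : Fin n → R))
  have hK₀ : K ≤ LinearMap.ker ((F.map u).hom ∘ₗ θ) := fun x hx ↦ by
    simpa using ConcreteCategory.congr_hom hu ⟨x, hx⟩
  refine ⟨k, ModuleCat.ofHom (K.liftQ _ hK₀ ∘ₗ e.toLinearMap), ?_⟩
  ext m
  obtain ⟨x, rfl⟩ : ∃ x, π x = m := by
    obtain ⟨x, hx⟩ := K.mkQ_surjective (e m)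
    exact ⟨x, by simp [π, hx]⟩
  have h₁ := LinearMap.congr_fun hθ x
  have h₂ : c.ι.app k (F.map u (θ x)) = c.ι.app j (θ x) := by
    rw [← ConcreteCategory.comp_apply, c.w]
  have h₃ : e (π x) = K.mkQ x := by simp [π]
  simpa [h₃, h₂] using h₂.trans h₁

lemma isPresentable_of_finite [IsNoetherianRing R] (M : ModuleCat.{u} R) [Module.Finite R M] :
    IsPresentable Cardinal.aleph0 M := by
  intro J _ hJ
  have := hJ.isFiltered
  have : Module.FinitePresentation R M := Module.finitePresentation_of_finite R M
  refine ⟨⟨fun {F} ↦ ⟨fun {c} hc ↦ ⟨Types.FilteredColimit.isColimitOf' _ _ (fun φ ↦ ?_)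
    fun j φ ψ h ↦ ?_⟩⟩⟩⟩
  · obtain ⟨j, ψ, h⟩ := exists_comp_ι_eq hc φ
    exact ⟨j, ψ, h.symm⟩
  · exact exists_comp_map_eq hc φ ψ h

end Presentable

/-- A linear map from a finite module to a free module has image in a finite free submodule. -/
lemma exists_supported_of_fg {R : Type*} [Ring R] {M ι : Type*} [AddCommGroup M] [Module R M]
    [Module.Finite R M] (φ : M →ₗ[R] ι →₀ R) :
    ∃ t : Finset ι, ∀ m, φ m ∈ Finsupp.supported R R (t : Set ι) := by
  classical
  obtain ⟨s, hs⟩ := Module.Finite.fg_top (R := R) (M := M)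
  refine ⟨s.biUnion fun m ↦ (φ m).support, fun m ↦ ?_⟩
  have h : Submodule.span R (s : Set M) ≤ (Finsupp.supported R R
      ((s.biUnion fun m ↦ (φ m).support : Finset ι) : Set ι)).comap φ := by
    refine Submodule.span_le.2 fun x hx ↦ ?_
    exact (Finsupp.mem_supported R (φ x)).2
      (Finset.coe_subset.2 (Finset.subset_biUnion_of_mem (fun m ↦ (φ m).support) hx))
  exact h (hs ▸ Submodule.mem_top)

instance {R : Type*} [Ring R] {ι : Type*} (S : Finset ι) :
    Module.Finite R (Finsupp.supported R R (S : Set ι)) :=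
  Module.Finite.equiv (Finsupp.supportedEquivFinsupp (S : Set ι)).symm

instance {R : Type*} [Ring R] {ι : Type*} (S : Finset ι) :
    Module.Projective R (Finsupp.supported R R (S : Set ι)) :=
  Module.Projective.of_equiv (Finsupp.supportedEquivFinsupp (S : Set ι)).symm

/-- Recognizing filtered colimits of modules. -/
noncomputable def isColimitOfJointly {R : Type u} [Ring R] {J : Type u} [SmallCategory J]
    [IsFiltered J] {F : J ⥤ ModuleCat.{u} R} (c : Cocone F)
    (hsurj : ∀ x : c.pt, ∃ (j : J) (y : F.obj j), c.ι.app j y = x)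
    (hinj : ∀ (j : J) (x : F.obj j), c.ι.app j x = 0 → ∃ (k : J) (u : j ⟶ k), F.map u x = 0) :
    IsColimit c :=
  isColimitOfReflects (forget (ModuleCat.{u} R)) <|
    Types.FilteredColimit.isColimitOf' _ _
      (fun x ↦ by
        obtain ⟨j, y, h⟩ := hsurj x
        exact ⟨j, y, h.symm⟩)
      fun j x y h ↦ by
        have h' : c.ι.app j x = c.ι.app j y := h
        obtain ⟨k, u, hu⟩ := hinj j (x - y : F.obj j) (by rw [map_sub, h', sub_self])
        rw [map_sub, sub_eq_zero] at hu
        exact ⟨k, u, hu⟩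

/-- The data exhibiting `X` as a direct sum of `A` and the free module on `ι`. -/
structure FreeComplement (R : Type u) [Ring R] (A X ι : Type u) [AddCommGroup A] [Module R A]
    [AddCommGroup X] [Module R X] where
  inl : A →ₗ[R] X
  inr : (ι →₀ R) →ₗ[R] X
  fst : X →ₗ[R] A
  snd : X →ₗ[R] ι →₀ R
  fst_inl : ∀ a, fst (inl a) = a
  snd_inl : ∀ a, snd (inl a) = 0
  fst_inr : ∀ v, fst (inr v) = 0
  snd_inr : ∀ v, snd (inr v) = v
  inl_fst_add : ∀ x, inl (fst x) + inr (snd x) = x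

section Stable

variable {R : Type u} [Ring R] {A B C M : ModuleCat.{u} R}

namespace FactorsThroughProjective

lemma of_projective (Q : Type u) [AddCommGroup Q] [Module R Q] [Module.Projective R Q]
    (g : A →ₗ[R] Q) (h : Q →ₗ[R] B) :
    FactorsThroughProjective (ModuleCat.ofHom (h ∘ₗ g)) :=
  ⟨ModuleCat.of R Q, ModuleCat.ofHom g, ModuleCat.ofHom h,
    (IsProjective.iff_projective Q).1 inferInstance, rfl⟩

lemma comp_left {f : A ⟶ B} (hf : FactorsThroughProjective f) (g : C ⟶ A) :
    FactorsThroughProjective (g ≫ f) := by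
  obtain ⟨P, a, b, hP, rfl⟩ := hf
  exact ⟨P, g ≫ a, b, hP, by simp⟩

lemma comp_right {f : A ⟶ B} (hf : FactorsThroughProjective f) (g : B ⟶ C) :
    FactorsThroughProjective (f ≫ g) := by
  obtain ⟨P, a, b, hP, rfl⟩ := hf
  exact ⟨P, a, b ≫ g, hP, by simp⟩

lemma neg {f : A ⟶ B} (hf : FactorsThroughProjective f) : FactorsThroughProjective (-f) := by
  simpa using hf.comp_right (-𝟙 B)

lemma add {f g : A ⟶ B} (hf : FactorsThroughProjective f) (hg : FactorsThroughProjective g) :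
    FactorsThroughProjective (f + g) := by
  obtain ⟨P, a, b, hP, rfl⟩ := hf
  obtain ⟨Q, a', b', hQ, rfl⟩ := hg
  have : Module.Projective R P := P.projective_of_module_projective
  have : Module.Projective R Q := Q.projective_of_module_projective
  convert of_projective (P × Q) (a.hom.prod a'.hom) (b.hom.coprod b'.hom) using 1
  ext x
  simp

lemma sub {f g : A ⟶ B} (hf : FactorsThroughProjective f) (hg : FactorsThroughProjective g) :
    FactorsThroughProjective (f - g) :=
  sub_eq_add_neg f g ▸ hf.add hg.neg

/-- A map from a finite module which factors through a projective module factors through a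
finite one. -/
lemma exists_finite [Module.Finite R M] {f : M ⟶ B} (hf : FactorsThroughProjective f) :
    ∃ (P : ModuleCat.{u} R) (g : M ⟶ P) (h : P ⟶ B),
      Module.Finite R P ∧ Projective P ∧ f = g ≫ h := by
  obtain ⟨Q, a, b, hQ, rfl⟩ := hf
  have : Module.Projective R Q := Q.projective_of_module_projective
  obtain ⟨s, hs⟩ := Module.projective_def'.1 this
  obtain ⟨t, ht⟩ := exists_supported_of_fg (s ∘ₗ a.hom)
  refine ⟨ModuleCat.of R (Finsupp.supported R R (t : Set Q)),
    ModuleCat.ofHom ((s ∘ₗ a.hom).codRestrict _ ht),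
    ModuleCat.ofHom (b.hom ∘ₗ Finsupp.linearCombination R id ∘ₗ Submodule.subtype _),
    inferInstanceAs (Module.Finite R (Finsupp.supported R R (t : Set Q))),
    (IsProjective.iff_projective _).1 inferInstance, ?_⟩
  ext m
  simpa using congrArg b.hom (LinearMap.congr_fun hs (a m)).symm

end FactorsThroughProjective

/-- A morphism inducing bijections on stable morphisms out of finite modules. -/
structure IsFiniteStableEquivalence (f : A ⟶ B) : Prop where
  surj : ∀ (M : ModuleCat.{u} R) [Module.Finite R M] (b : M ⟶ B),
    ∃ a : M ⟶ A, FactorsThroughProjective (a ≫ f - b)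
  inj : ∀ (M : ModuleCat.{u} R) [Module.Finite R M] (a : M ⟶ A),
    FactorsThroughProjective (a ≫ f) → FactorsThroughProjective a

lemma IsStableEquivalence.isFiniteStableEquivalence {f : A ⟶ B} (hf : IsStableEquivalence f) :
    IsFiniteStableEquivalence f := by
  obtain ⟨g, hfg, hgf⟩ := hf
  refine ⟨fun M _ b ↦ ⟨b ≫ g, ?_⟩, fun M _ a ha ↦ ?_⟩
  · simpa using hgf.comp_left b
  · simpa using (ha.comp_right g).sub (hfg.comp_left a)

/-- Over a quasi-Frobenius ring, the kernel of a surjection `g : A ⊕ R^(ι) → B` extending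
`f : A ⟶ B` is injective as soon as `f` induces bijections on stable morphisms out of finite
modules. -/
lemma IsFiniteStableEquivalence.injective_ker [IsNoetherianRing R]
    (hR : ∀ (P : Type u) [AddCommGroup P] [Module R P],
      Module.Projective R P ↔ Module.Injective R P)
    {f : A ⟶ B} (hf : IsFiniteStableEquivalence f) {X ι : Type u} [AddCommGroup X] [Module R X]
    (e : FreeComplement R A X ι) (g : X →ₗ[R] B) (hg : Function.Surjective g)
    (hgf : ∀ a, g (e.inl a) = f a) :
    Module.Injective R (LinearMap.ker g) := by
  refine Module.Baer.injective fun I φ ↦ ?_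
  let φ₁ : I →ₗ[R] A := e.fst ∘ₗ Submodule.subtype _ ∘ₗ φ
  let φ₂ : I →ₗ[R] ι →₀ R := e.snd ∘ₗ Submodule.subtype _ ∘ₗ φ
  have hφ : ∀ x, f (φ₁ x) + g (e.inr (φ₂ x)) = 0 := fun x ↦ by
    rw [← hgf, ← map_add]
    exact (congrArg g (e.inl_fst_add _)).trans (φ x).2
  obtain ⟨Q, a, b, hQ, hab⟩ := hf.inj (ModuleCat.of R I) (ModuleCat.ofHom φ₁) (by
    convert FactorsThroughProjective.of_projective (A := ModuleCat.of R I) (ι →₀ R) φ₂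
      (-(g ∘ₗ e.inr)) using 1
    ext x
    simpa using eq_neg_of_add_eq_zero_left (hφ x))
  have : Module.Projective R Q := Q.projective_of_module_projective
  obtain ⟨a', ha'⟩ := ((hR Q).1 this).out I.subtype I.subtype_injective a.hom
  obtain ⟨ψ₂, hψ₂⟩ := ((hR (ι →₀ R)).1 inferInstance).out I.subtype I.subtype_injective φ₂
  have hψ₁ : ∀ x : I, b (a' x) = φ₁ x := fun x ↦ by
    have := ConcreteCategory.congr_hom hab x
    simpa [← ha'] using this.symm
  let ψ : R →ₗ[R] X := e.inl ∘ₗ b.hom ∘ₗ a' + e.inr ∘ₗ ψ₂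
  have hψ : ∀ x : I, ψ x = φ x := fun x ↦ by
    refine Eq.trans ?_ (e.inl_fst_add (φ x))
    exact congrArg₂ (fun y z ↦ e.inl y + e.inr z) (hψ₁ x) (hψ₂ x)
  let β : (R ⧸ I) →ₗ[R] B := Submodule.liftQ I (g ∘ₗ ψ) fun x hx ↦ by
    rw [LinearMap.mem_ker, LinearMap.comp_apply, hψ ⟨x, hx⟩]
    exact (φ ⟨x, hx⟩).2
  obtain ⟨α, Q', c, d, hQ', hcd⟩ := hf.surj (ModuleCat.of R (R ⧸ I)) (ModuleCat.ofHom β)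
  have : Module.Projective R Q' := Q'.projective_of_module_projective
  obtain ⟨d', hd'⟩ := Module.projective_lifting_property g d.hom hg
  let γ : (R ⧸ I) →ₗ[R] X := e.inl ∘ₗ α.hom - d' ∘ₗ c.hom
  have hγ : ∀ x, g (γ x) = β x := fun x ↦ by
    have h₁ : f (α x) - β x = d (c x) := ConcreteCategory.congr_hom hcd x
    have h₂ : g (d' (c x)) = d (c x) := LinearMap.congr_fun hd' (c x)
    calc g (γ x) = g (e.inl (α x)) - g (d' (c x)) := map_sub _ _ _
      _ = β x := by rw [h₂, hgf, ← h₁, sub_sub_cancel]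
  refine ⟨(ψ - γ ∘ₗ I.mkQ).codRestrict _ fun x ↦ ?_, fun x hx ↦ Subtype.ext ?_⟩
  · rw [LinearMap.mem_ker, LinearMap.sub_apply, map_sub, LinearMap.comp_apply, hγ]
    simp [β]
  · have : I.mkQ x = 0 := (Submodule.Quotient.mk_eq_zero I).2 hx
    simp [this, hψ ⟨x, hx⟩]

/-- If `i : A → X` has a left inverse `π` such that `1 - i π` factors through a projective module,
and `g : X → B` is a surjection whose kernel is both injective and projective, then `g i` is a
stable equivalence. -/
lemma isStableEquivalence_of_surjective {X : Type u} [AddCommGroup X] [Module R X]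
    (f : A ⟶ B) (i : A →ₗ[R] X) (π : X →ₗ[R] A) (hπ : π ∘ₗ i = LinearMap.id)
    {P : Type u} [AddCommGroup P] [Module R P] [Module.Projective R P]
    (q : X →ₗ[R] P) (h : P →ₗ[R] X) (hqh : ∀ x, i (π x) + h (q x) = x)
    (g : X →ₗ[R] B) (hg : Function.Surjective g) (hf : ∀ a, g (i a) = f a)
    [Module.Projective R (LinearMap.ker g)] (hI : Module.Injective R (LinearMap.ker g)) :
    IsStableEquivalence f := by
  obtain ⟨r, hr⟩ := hI.out (LinearMap.ker g).subtype (Submodule.subtype_injective _) LinearMap.id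
  have hker : ∀ x, g (r x) = 0 := fun x ↦ (r x).2
  let s₀ : X →ₗ[R] X := LinearMap.id - (LinearMap.ker g).subtype ∘ₗ r
  have hs₀ : LinearMap.ker g ≤ LinearMap.ker s₀ := fun x hx ↦ by
    simpa [s₀, sub_eq_zero] using (congrArg Subtype.val (hr ⟨x, hx⟩)).symm
  let s : B →ₗ[R] X :=
    (LinearMap.ker g).liftQ s₀ hs₀ ∘ₗ (g.quotKerEquivOfSurjective hg).symm.toLinearMap
  have hs : ∀ x, s (g x) = x - r x := fun x ↦ by
    have : (g.quotKerEquivOfSurjective hg).symm (g x) = (LinearMap.ker g).mkQ x := by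
      rw [LinearEquiv.symm_apply_eq]
      rfl
    simp [s, this, s₀]
  have hgs : ∀ b, g (s b) = b := fun b ↦ by
    obtain ⟨x, rfl⟩ := hg b
    rw [hs, map_sub, hker, sub_zero]
  refine ⟨ModuleCat.ofHom (π ∘ₗ s), ?_, ?_⟩
  · convert (FactorsThroughProjective.of_projective (A := A) (B := A) (LinearMap.ker g)
      (r ∘ₗ i) (π ∘ₗ (LinearMap.ker g).subtype)).neg using 1
    ext a
    have : π (i a) = a := LinearMap.congr_fun hπ a
    simp [← hf, hs, this]
  · convert (FactorsThroughProjective.of_projective (A := B) (B := B) P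
      (q ∘ₗ s) (g ∘ₗ h)).neg using 1
    ext b
    have : g (i (π (s b))) + g (h (q (s b))) = b := by rw [← map_add, hqh, hgs]
    simpa [← hf] using sub_eq_iff_eq_add.2 (eq_add_neg_of_add_eq this |>.trans (add_comm _ _))

end Stable

section Frobenius

variable {R : Type u} [Ring R] [IsNoetherianRing R]

/-- Inducing bijections on stable morphisms out of finite modules is stable under filtered
colimits. -/
lemma isFiniteStableEquivalence_of_isColimit {J : Type u} [SmallCategory J] [IsFiltered J]
    {F G : J ⥤ ModuleCat.{u} R} (α : F ⟶ G) {c : Cocone F} {d : Cocone G} (hc : IsColimit c)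
    (hd : IsColimit d) (f : c.pt ⟶ d.pt) (hf : ∀ j, c.ι.app j ≫ f = α.app j ≫ d.ι.app j)
    (hα : ∀ j, IsFiniteStableEquivalence (α.app j)) : IsFiniteStableEquivalence f := by
  refine ⟨fun M _ b ↦ ?_, fun M _ a ha ↦ ?_⟩
  · have := Module.finitePresentation_of_finite R M
    obtain ⟨j, b, rfl⟩ := exists_comp_ι_eq hd b
    obtain ⟨a, ha⟩ := (hα j).surj M b
    refine ⟨a ≫ c.ι.app j, ?_⟩
    simpa [hf] using ha.comp_right (d.ι.app j)
  · have := Module.finitePresentation_of_finite R M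
    obtain ⟨P, g, h, _, hP, hgh⟩ := ha.exists_finite
    have := Module.finitePresentation_of_finite R P
    obtain ⟨i, a, rfl⟩ := exists_comp_ι_eq hc a
    obtain ⟨j, h, rfl⟩ := exists_comp_ι_eq hd h
    let u := IsFiltered.leftToMax i j
    let v := IsFiltered.rightToMax i j
    obtain ⟨k, w, hw⟩ := exists_comp_map_eq hd
      (a ≫ F.map u ≫ α.app _) (g ≫ h ≫ G.map v) (by simpa [hf] using hgh)
    have := ((hα k).inj M (a ≫ F.map (u ≫ w))
      ⟨P, g, h ≫ G.map (v ≫ w), hP, by simpa using hw⟩).comp_right (c.ι.app k)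
    simpa using this

/-- Over a left Noetherian ring, a finitely generated submodule `D` of a finite injective module
which is disjoint from `N` is contained in a direct summand disjoint from `N`. -/
lemma exists_isCompl_of_injective {E : Type u} [AddCommGroup E] [Module R E] [Module.Finite R E]
    (hE : Module.Injective R E) {D N : Submodule R E} (hDN : Disjoint D N) :
    ∃ E₁ E₂ : Submodule R E, D ≤ E₁ ∧ N ≤ E₂ ∧ IsCompl E₁ E₂ := by
  obtain ⟨C, hNC, hC⟩ := exists_maximal_ge_of_wellFoundedGT (Disjoint D) N hDN
  obtain ⟨E₁, hDE, hE₁⟩ := exists_maximal_ge_of_wellFoundedGT (Disjoint · C) D hC.prop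
  have hinj : Function.Injective (E₁.mkQ ∘ₗ C.subtype) := by
    rw [← LinearMap.ker_eq_bot, LinearMap.ker_eq_bot']
    intro x hx
    have hxE : (x : E) ∈ E₁ := by simpa using hx
    exact Subtype.ext (Submodule.disjoint_def.1 hE₁.prop x hxE x.2)
  obtain ⟨θ₀, hθ₀⟩ := hE.out _ hinj C.subtype
  let θ : E →ₗ[R] E := θ₀ ∘ₗ E₁.mkQ
  have hθC : ∀ x ∈ C, θ x = x := fun x hx ↦ hθ₀ ⟨x, hx⟩
  have hθE : ∀ x ∈ E₁, θ x = 0 := fun x hx ↦ by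
    simp [θ, (Submodule.Quotient.mk_eq_zero E₁).2 hx]
  have hker : LinearMap.ker θ = E₁ := by
    refine (hE₁.eq_of_le ?_ fun x hx ↦ hθE x hx).symm
    refine Submodule.disjoint_def.2 fun x hx hxC ↦ ?_
    rw [← hθC x hxC, LinearMap.mem_ker.1 hx]
  have hrange : C = LinearMap.range θ := by
    refine hC.eq_of_le ?_ fun x hx ↦ ⟨x, hθC x hx⟩
    rw [Submodule.disjoint_def]
    rintro _ hd ⟨y, rfl⟩
    by_contra hy
    have hlt : ¬ Disjoint (E₁ ⊔ Submodule.span R {y}) C := fun hdis ↦ by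
      have : y ∈ E₁ := by
        rw [hE₁.eq_of_le hdis le_sup_left]
        exact Submodule.mem_sup_right (Submodule.mem_span_singleton_self y)
      exact hy (hθE y this)
    refine hlt (Submodule.disjoint_def.2 fun x hx hxC ↦ ?_)
    obtain ⟨e, he, _, hz, rfl⟩ := Submodule.mem_sup.1 hx
    obtain ⟨r, rfl⟩ := Submodule.mem_span_singleton.1 hz
    have hθ : r • θ y = e + r • y := by
      rw [← hθC _ hxC, map_add, hθE e he, zero_add, map_smul]
    rw [← hθ]
    exact Submodule.disjoint_def.1 hC.prop _ (D.smul_mem r hd) (hθ ▸ hxC)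
  refine ⟨E₁, C, hDE, hNC, hE₁.prop, codisjoint_iff.2 (eq_top_iff.2 fun x _ ↦ ?_)⟩
  have hx : θ x ∈ C := hrange ▸ LinearMap.mem_range_self θ x
  have hxE : x - θ x ∈ E₁ := by
    rw [← hker, LinearMap.mem_ker, map_sub, hθC _ hx, sub_self]
  exact Submodule.mem_sup.2 ⟨_, hxE, _, hx, sub_add_cancel x (θ x)⟩

lemma exists_projective_ge_of_injective {V X : Type u} [AddCommGroup V] [Module R V]
    [Module.Finite R V] [Module.Projective R V] (hV : Module.Injective R V)
    [AddCommGroup X] [Module R X] (D : Submodule R X) (i : D →ₗ[R] V) (ρ : V →ₗ[R] X)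
    (hρi : ∀ d, ρ (i d) = d) :
    ∃ E : Submodule R X, D ≤ E ∧ E ≤ LinearMap.range ρ ∧ E.FG ∧ Module.Projective R E := by
  obtain ⟨E₁, E₂, hE₁, hE₂, hE⟩ := exists_isCompl_of_injective hV
    (D := LinearMap.range i) (N := LinearMap.ker ρ) (by
      rw [Submodule.disjoint_def]
      rintro _ ⟨d, rfl⟩ hd
      have : d = 0 := Subtype.ext ((hρi d).symm.trans hd)
      simp [this])
  have hinj : Function.Injective (ρ ∘ₗ E₁.subtype) := by
    rw [← LinearMap.ker_eq_bot, LinearMap.ker_eq_bot']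
    exact fun x hx ↦ Subtype.ext (Submodule.disjoint_def.1 hE.disjoint x x.2 (hE₂ hx))
  have : Module.Projective R E₁ := Module.Projective.of_split E₁.subtype
    (E₁.projectionOnto E₂ hE) (by ext x; simp)
  exact ⟨LinearMap.range (ρ ∘ₗ E₁.subtype), fun d hd ↦ ⟨⟨i ⟨d, hd⟩, hE₁ ⟨_, rfl⟩⟩, hρi _⟩,
    LinearMap.range_comp_le_range _ _, Module.Finite.iff_fg.1 inferInstance,
    Module.Projective.of_equiv (LinearEquiv.ofInjective _ hinj)⟩

/-- Over a quasi-Frobenius ring, finitely generated submodules of a projective module are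
contained in finitely generated projective submodules. -/
lemma exists_projective_ge
    (hR : ∀ (P : Type u) [AddCommGroup P] [Module R P],
      Module.Projective R P ↔ Module.Injective R P)
    {X : Type u} [AddCommGroup X] [Module R X] (K : Submodule R X) [hK : Module.Projective R K]
    (D : Submodule R X) (hD : D.FG) (hDK : D ≤ K) :
    ∃ E : Submodule R X, D ≤ E ∧ E ≤ K ∧ E.FG ∧ Module.Projective R E := by
  obtain ⟨s, hs⟩ := Module.projective_def'.1 hK
  have : Module.Finite R D := Module.Finite.iff_fg.2 hD
  obtain ⟨t, ht⟩ := exists_supported_of_fg (s ∘ₗ Submodule.inclusion hDK)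
  let e := Finsupp.supportedEquivFinsupp (M := R) (R := R) (t : Set K)
  let ρ := K.subtype ∘ₗ Finsupp.linearCombination R id ∘ₗ Submodule.subtype _ ∘ₗ e.symm.toLinearMap
  obtain ⟨E, hDE, hE, h⟩ := exists_projective_ge_of_injective
    ((hR (t →₀ R)).1 inferInstance) D
    (e.toLinearMap ∘ₗ (s ∘ₗ Submodule.inclusion hDK).codRestrict _ ht) ρ fun d ↦ by
      simpa [ρ] using congrArg Subtype.val (LinearMap.congr_fun hs (Submodule.inclusion hDK d))
  refine ⟨E, hDE, hE.trans ?_, h⟩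
  rintro _ ⟨x, rfl⟩
  exact Subtype.property _

end Frobenius

section FiniteStages

variable {R : Type u} [Ring R] {A X ι : Type u} [AddCommGroup A] [Module R A] [AddCommGroup X]
  [Module R X]

/-- A finite stage of a quotient `(A ⊕ R^(ι)) / K`: a finitely generated submodule `M` of `A`, a
finite subset `S` of `ι` and a projective submodule `E` of `K` contained in `M ⊕ R^S`. -/
structure FiniteStage (e : FreeComplement R A X ι) (K : Submodule R X) where
  M : Submodule R A
  S : Finset ι
  E : Submodule R X
  fg : M.FG
  projective : Module.Projective R E
  le : E ≤ K
  fst_mem : ∀ x ∈ E, e.fst x ∈ M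
  snd_mem : ∀ x ∈ E, e.snd x ∈ Finsupp.supported R R (S : Set ι)

namespace FiniteStage

variable {e : FreeComplement R A X ι} {K : Submodule R X}

instance : Preorder (FiniteStage e K) := Preorder.lift fun j ↦ (j.M, j.S, j.E)

/-- The submodule `M ⊕ R^S` of `A ⊕ R^(ι)`. -/
noncomputable def total (j : FiniteStage e K) : Submodule R X :=
  j.M.comap e.fst ⊓ (Finsupp.supported R R (j.S : Set ι)).comap e.snd

lemma M_le {i j : FiniteStage e K} (h : i ≤ j) : i.M ≤ j.M := h.1

lemma E_le {i j : FiniteStage e K} (h : i ≤ j) : i.E ≤ j.E := h.2.2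

lemma total_le {i j : FiniteStage e K} (h : i ≤ j) : i.total ≤ j.total :=
  inf_le_inf (Submodule.comap_mono h.1)
    (Submodule.comap_mono (Finsupp.supported_mono (Finset.coe_subset.2 h.2.1)))

lemma E_le_total (j : FiniteStage e K) : j.E ≤ j.total :=
  fun x hx ↦ ⟨j.fst_mem x hx, j.snd_mem x hx⟩

/-- The codomain `(M ⊕ R^S) / E` of the arrow associated to a finite stage. -/
abbrev Quot (j : FiniteStage e K) : Type u := j.total ⧸ j.E.submoduleOf j.total

/-- The inclusion `M → M ⊕ R^S`. -/
noncomputable def inl (j : FiniteStage e K) : j.M →ₗ[R] j.total :=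
  (e.inl ∘ₗ j.M.subtype).codRestrict _ fun x ↦
    ⟨by simp [e.fst_inl], by simp [e.snd_inl]⟩

/-- The transition map between the codomains of two finite stages. -/
noncomputable def quotMap {i j : FiniteStage e K} (h : i ≤ j) : i.Quot →ₗ[R] j.Quot :=
  Submodule.mapQ _ _ (Submodule.inclusion (total_le h)) fun _ hx ↦ E_le h hx

variable (e K) in
/-- The diagram of arrows `M → (M ⊕ R^S) / E` indexed by the finite stages. -/
noncomputable def diagram : FiniteStage e K ⥤ Arrow (ModuleCat.{u} R) where
  obj j := Arrow.mk (ModuleCat.ofHom ((j.E.submoduleOf j.total).mkQ ∘ₗ j.inl))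
  map {i j} u := Arrow.homMk (ModuleCat.ofHom (Submodule.inclusion (M_le (leOfHom u))))
    (ModuleCat.ofHom (quotMap (leOfHom u))) rfl
  map_id j := by
    ext x
    · rfl
    · obtain ⟨x, rfl⟩ := Submodule.mkQ_surjective _ x
      rfl
  map_comp {i j k} u v := by
    ext x
    · rfl
    · obtain ⟨x, rfl⟩ := Submodule.mkQ_surjective _ x
      rfl

/-- The cocone of the diagram of finite stages of the kernel of `g : A ⊕ R^(ι) → B`. -/
noncomputable def cocone {A B : ModuleCat.{u} R} (e : FreeComplement R A X ι) (f : A ⟶ B)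
    (g : X →ₗ[R] B) (hgf : ∀ a, g (e.inl a) = f a) : Cocone (diagram e (LinearMap.ker g)) where
  pt := Arrow.mk f
  ι :=
    { app j := Arrow.homMk (ModuleCat.ofHom j.M.subtype)
        (ModuleCat.ofHom (Submodule.liftQ _ (g ∘ₗ j.total.subtype) fun _ hx ↦ j.le hx))
        (by ext x; exact (hgf _).symm)
      naturality i j u := by
        ext x
        · rfl
        · obtain ⟨x, rfl⟩ := Submodule.mkQ_surjective _ x
          rfl }

instance (j : FiniteStage e K) : Module.Finite R j.M := Module.Finite.iff_fg.2 j.fg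

section Noetherian

variable [IsNoetherianRing R]

lemma fg_of_le_total {j : FiniteStage e K} {N : Submodule R X} (hN : N ≤ j.total) : N.FG := by
  have hfg : (j.M.map e.inl ⊔ (Finsupp.supported R R (j.S : Set ι)).map e.inr).FG :=
    (j.fg.map _).sup ((Module.Finite.iff_fg.1 inferInstance).map _)
  have := isNoetherian_of_fg_of_noetherian _ hfg
  refine isNoetherian_submodule.1 this N (hN.trans fun x hx ↦ ?_)
  rw [← e.inl_fst_add x]
  exact Submodule.add_mem_sup ⟨_, hx.1, rfl⟩ ⟨_, hx.2, rfl⟩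

instance (j : FiniteStage e K) : Module.Finite R j.total :=
  Module.Finite.iff_fg.2 (fg_of_le_total le_rfl)

lemma exists_ge
    (hR : ∀ (P : Type u) [AddCommGroup P] [Module R P],
      Module.Projective R P ↔ Module.Injective R P)
    (e : FreeComplement R A X ι) [Module.Projective R K] {M : Submodule R A}
    (hM : M.FG) (S : Finset ι) {D : Submodule R X} (hD : D.FG) (hDK : D ≤ K) :
    ∃ j : FiniteStage e K, M ≤ j.M ∧ S ⊆ j.S ∧ D ≤ j.E := by
  classical
  obtain ⟨E, hDE, hEK, hE, hproj⟩ := exists_projective_ge hR K D hD hDK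
  have : Module.Finite R E := Module.Finite.iff_fg.2 hE
  obtain ⟨t, ht⟩ := exists_supported_of_fg (e.snd ∘ₗ E.subtype)
  refine ⟨⟨M ⊔ E.map e.fst, S ∪ t, E, hM.sup (hE.map _), hproj, hEK,
    fun x hx ↦ Submodule.mem_sup_right ⟨x, hx, rfl⟩, fun x hx ↦ ?_⟩, le_sup_left,
    Finset.subset_union_left, hDE⟩
  exact Finsupp.supported_mono (by simp) (ht ⟨x, hx⟩)

lemma isFiltered
    (hR : ∀ (P : Type u) [AddCommGroup P] [Module R P],
      Module.Projective R P ↔ Module.Injective R P)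
    (e : FreeComplement R A X ι) (K : Submodule R X) [Module.Projective R K] :
    IsFiltered (FiniteStage e K) := by
  classical
  have : Nonempty (FiniteStage e K) :=
    let ⟨j, _⟩ := exists_ge hR e (K := K) (M := ⊥) Submodule.fg_bot ∅ Submodule.fg_bot bot_le
    ⟨j⟩
  have : IsDirectedOrder (FiniteStage e K) := ⟨fun i j ↦ by
    obtain ⟨k, hM, hS, hE⟩ := exists_ge hR e (i.fg.sup j.fg) (i.S ∪ j.S)
      ((fg_of_le_total i.E_le_total).sup (fg_of_le_total j.E_le_total)) (sup_le i.le j.le)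
    exact ⟨k, ⟨le_sup_left.trans hM, Finset.subset_union_left.trans hS, le_sup_left.trans hE⟩,
      ⟨le_sup_right.trans hM, Finset.subset_union_right.trans hS, le_sup_right.trans hE⟩⟩⟩
  infer_instance

/-- The arrows `M → (M ⊕ R^S) / E` are stable equivalences between finite modules. -/
lemma diagram_obj_mem
    (hR : ∀ (P : Type u) [AddCommGroup P] [Module R P],
      Module.Projective R P ↔ Module.Injective R P)
    (j : FiniteStage e K) :
    (diagram e K).obj j ∈ PresentableArrowsIn Cardinal.aleph0
      {a : Arrow (ModuleCat.{u} R) | IsStableEquivalence a.hom} := by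
  refine ⟨?_, isPresentable_of_finite (ModuleCat.of R j.M),
    isPresentable_of_finite (ModuleCat.of R j.Quot)⟩
  have hE : Module.Projective R (LinearMap.ker (j.E.submoduleOf j.total).mkQ) := by
    have := j.projective
    rw [Submodule.ker_mkQ]
    exact Module.Projective.of_equiv (Submodule.submoduleOfEquivOfLe j.E_le_total).symm
  let V := Finsupp.supported R R (j.S : Set ι)
  let snd : j.total →ₗ[R] V := (e.snd ∘ₗ j.total.subtype).codRestrict V fun x ↦ x.2.2
  let inr : V →ₗ[R] j.total := (e.inr ∘ₗ V.subtype).codRestrict j.total fun v ↦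
    ⟨by simp [e.fst_inr], by simp [e.snd_inr, V]⟩
  let fst : j.total →ₗ[R] j.M := (e.fst ∘ₗ j.total.subtype).codRestrict j.M fun x ↦ x.2.1
  have hadd : ∀ x, j.inl (fst x) + inr (snd x) = x := fun x ↦ Subtype.ext (e.inl_fst_add x)
  exact isStableEquivalence_of_surjective (A := ModuleCat.of R j.M) (B := ModuleCat.of R j.Quot)
    (P := V) _ j.inl fst (by ext x; exact e.fst_inl x)
    snd inr hadd (j.E.submoduleOf j.total).mkQ
    (Submodule.mkQ_surjective _) (fun _ ↦ rfl) ((hR _).1 hE)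

/-- If the kernel of `g : A ⊕ R^(ι) → B` is projective, then the restriction of `g` to `A` is the
colimit of its finite stages. -/
lemma nonempty_isColimit_cocone
    (hR : ∀ (P : Type u) [AddCommGroup P] [Module R P],
      Module.Projective R P ↔ Module.Injective R P)
    {A B : ModuleCat.{u} R} (e : FreeComplement R A X ι) (f : A ⟶ B)
    (g : X →ₗ[R] B) (hg : Function.Surjective g) (hgf : ∀ a, g (e.inl a) = f a)
    [Module.Projective R (LinearMap.ker g)] : Nonempty (IsColimit (cocone e f g hgf)) := by
  have := isFiltered hR e (LinearMap.ker g)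
  refine ⟨Comma.fstSndJointlyReflectColimit ?_ ?_⟩
  · refine isColimitOfJointly _ (fun (a : A) ↦ ?_) fun j x hx ↦ ⟨j, 𝟙 j, ?_⟩
    · obtain ⟨j, hj, -⟩ := exists_ge hR e (K := LinearMap.ker g)
        (Submodule.fg_span_singleton a) ∅ Submodule.fg_bot bot_le
      exact ⟨j, (⟨a, hj (Submodule.mem_span_singleton_self a)⟩ : j.M), rfl⟩
    · exact (Subtype.ext hx : Submodule.inclusion le_rfl (x : j.M) = 0)
  · refine isColimitOfJointly _ (fun (b : B) ↦ ?_) fun j x hx ↦ ?_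
    · obtain ⟨x, rfl⟩ := hg b
      obtain ⟨j, hM, hS, -⟩ := exists_ge hR e (K := LinearMap.ker g)
        (Submodule.fg_span_singleton (e.fst x)) (e.snd x).support Submodule.fg_bot bot_le
      have hx : x ∈ j.total := ⟨hM (Submodule.mem_span_singleton_self _),
        (Finsupp.mem_supported R _).2 (Finset.coe_subset.2 hS)⟩
      exact ⟨j, (Submodule.Quotient.mk ⟨x, hx⟩ : j.Quot), rfl⟩
    · obtain ⟨⟨x, hxt⟩, rfl⟩ := Submodule.mkQ_surjective (j.E.submoduleOf j.total) x
      have hgx : g x = 0 := hx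
      obtain ⟨k, hM, hS, hE⟩ := exists_ge hR e (K := LinearMap.ker g) j.fg j.S
        ((Submodule.fg_span_singleton x).sup (fg_of_le_total j.E_le_total))
        (sup_le ((Submodule.span_singleton_le_iff_mem _ _).2 hgx) j.le)
      refine ⟨k, homOfLE ⟨hM, hS, le_sup_right.trans hE⟩, ?_⟩
      exact (Submodule.Quotient.mk_eq_zero _).2
        (hE (Submodule.mem_sup_left (Submodule.mem_span_singleton_self x)))

end Noetherian

end FiniteStage

end FiniteStages

/-- Every morphism `f : A ⟶ B` extends to a surjection from the direct sum of `A` and a free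
module. -/
lemma exists_freeComplement {R : Type u} [Ring R] {A B : ModuleCat.{u} R} (f : A ⟶ B) :
    ∃ (X : ModuleCat.{u} R) (e : FreeComplement R A X B) (g : X →ₗ[R] B),
      Function.Surjective g ∧ ∀ a, g (e.inl a) = f a := by
  refine ⟨ModuleCat.of R (A × (B →₀ R)), ⟨LinearMap.inl R A (B →₀ R), LinearMap.inr R A (B →₀ R),
    LinearMap.fst R A (B →₀ R), LinearMap.snd R A (B →₀ R), fun _ ↦ rfl, fun _ ↦ rfl,
    fun _ ↦ rfl, fun _ ↦ rfl, fun x ↦ Prod.ext (add_zero _) (zero_add _)⟩,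
    f.hom.coprod (Finsupp.linearCombination R id), fun b ↦ ⟨(0, Finsupp.single b 1), ?_⟩,
    fun a ↦ ?_⟩
  · exact (LinearMap.coprod_apply _ _ _).trans (by simp)
  · exact (LinearMap.coprod_apply _ _ _).trans (by simp)

/-- Corollary 5.5. Let `R` be a Noetherian Frobenius (= quasi-Frobenius)
ring, i.e. a Noetherian ring over which the classes of projective and injective modules
coincide. Then the full subcategory `W_st` of the arrow category of `R`-modules spanned by
the stable equivalences is finitely accessible: it is closed under filtered colimits and
every stable equivalence is a filtered colimit of stable equivalences between finitely
presentable `R`-modules. -/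
theorem statement11 (R : Type u) [Ring R] [IsNoetherianRing R]
    (hFrobenius : ∀ P : ModuleCat.{u} R, Projective P ↔ Injective P) :
    ClosedUnderFilteredColimits Cardinal.aleph0
      {a : Arrow (ModuleCat.{u} R) | IsStableEquivalence a.hom} ∧
    ∀ {A B : ModuleCat.{u} R} (f : A ⟶ B), IsStableEquivalence f →
      Nonempty (FilteredColimitPresentation (M := Arrow (ModuleCat.{u} R)) Cardinal.aleph0
        (PresentableArrowsIn Cardinal.aleph0
          {a : Arrow (ModuleCat.{u} R) | IsStableEquivalence a.hom})
        (Arrow.mk f)) := by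
  have hR : ∀ (P : Type u) [AddCommGroup P] [Module R P],
      Module.Projective R P ↔ Module.Injective R P := fun P _ _ ↦ by
    rw [IsProjective.iff_projective, hFrobenius, Module.injective_iff_injective_object]
  refine ⟨fun J _ hJ F c hc hF ↦ ?_, fun {A B} f hf ↦ ?_⟩
  · have := hJ.isFiltered
    have hfin : IsFiniteStableEquivalence c.pt.hom :=
      isFiniteStableEquivalence_of_isColimit (Functor.whiskerLeft F Arrow.leftToRight)
        (isColimitOfPreserves Arrow.leftFunc hc) (isColimitOfPreserves Arrow.rightFunc hc)
        c.pt.hom (fun j ↦ (c.ι.app j).w) fun j ↦ (hF j).isFiniteStableEquivalence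
    obtain ⟨X, e, g, hg, hgf⟩ := exists_freeComplement c.pt.hom
    have hI := hfin.injective_ker hR e g hg hgf
    have := (hR _).2 hI
    exact isStableEquivalence_of_surjective _ e.inl e.fst (LinearMap.ext e.fst_inl) e.snd e.inr
      e.inl_fst_add g hg hgf hI
  · obtain ⟨X, e, g, hg, hgf⟩ := exists_freeComplement f
    have := (hR _).2 (hf.isFiniteStableEquivalence.injective_ker hR e g hg hgf)
    have := FiniteStage.isFiltered hR e (LinearMap.ker g)
    obtain ⟨hc⟩ := FiniteStage.nonempty_isColimit_cocone hR e f g hg hgf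
    exact ⟨⟨_, isCardinalFiltered_aleph0, _, FiniteStage.diagram_obj_mem hR, _, hc, Iso.refl _⟩⟩

end PaperAcc
end

section
/- Let M be a left proper κ-combinatorial model category satisfying: (i) there is a set A of κ-presentable cofibrant objects such that every object of M is a κ-filtered colimit of objects in A; and (iii) whenever a composite morphism i′ = q ∘ i is a cofibration between cofibrant objects, the morphism i is a formal cofibration. Let S be a set of morphisms in M. Suppose the left Bousfield localization L_S M of M at S is λ-combinatorial for some regular cardinal λ ≥ κ and that every λ-presentable cofibrant object in a generating set as in (i) for L_S M has a λ-presentable cylinder object in L_S M. Then the full subcategory W_S of (L_S M)^→ spanned by the S-local equivalences is λ-accessible: it is closed under λ-filtered colimits and every S-local equivalence is a λ-filtered colimit of S-local equivalences between λ-presentable objects. -/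
open CategoryTheory CategoryTheory.Limits

universe w v u

namespace PaperAcc

variable {M : Type u} [Category.{v} M]

section Bridges

lemma isCardinalFiltered_iff_mathlib (J : Type v) [SmallCategory J] (κ : Cardinal.{v})
    [Fact κ.IsRegular] :
    PaperAcc.IsCardinalFiltered J κ ↔ CategoryTheory.IsCardinalFiltered J κ := by
  constructor
  · intro h
    exact ⟨fun {A} _ F hA => h A ((hasCardinalLT_iff_cardinal_mk_lt _ _).1 hA) F⟩
  · intro h A _ hA F
    exact h.nonempty_cocone F ((hasCardinalLT_iff_cardinal_mk_lt _ _).2 hA)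

lemma isPresentable_iff_mathlib (κ : Cardinal.{v}) [Fact κ.IsRegular] (X : M) :
    PaperAcc.IsPresentable κ X ↔ IsCardinalPresentable X κ := by
  constructor
  · intro h
    exact ⟨fun J _ hJ => (h J ((isCardinalFiltered_iff_mathlib J κ).2 hJ)).some⟩
  · intro h J _ hJ
    have := (isCardinalFiltered_iff_mathlib J κ).1 hJ
    exact ⟨preservesColimitsOfShape_of_isCardinalPresentable X κ J⟩

lemma FilteredColimitPresentation.mem_colimitsOfShape {κ : Cardinal.{v}}
    {P : Set M} {X : M} (h : FilteredColimitPresentation κ P X) :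
    letI := h.instJ
    ObjectProperty.colimitsOfShape (fun Y => Y ∈ P) h.J X :=
  letI := h.instJ
  ⟨{ diag := h.F
     ι := h.c.ι ≫ (Functor.const _).map h.iso.hom
     isColimit := IsColimit.ofIsoColimit h.isColimit (Cocone.ext h.iso)
     prop_diag_obj := h.mem }⟩

lemma isCardinalFilteredGenerator_of_presentations (κ : Cardinal.{v}) [Fact κ.IsRegular]
    (P : Set M) (hP : ∀ X ∈ P, PaperAcc.IsPresentable κ X)
    (h : ∀ X : M, Nonempty (FilteredColimitPresentation κ P X)) :
    ObjectProperty.IsCardinalFilteredGenerator (fun Y => Y ∈ P) κ where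
  le_isCardinalPresentable X hX := (isPresentable_iff_mathlib κ X).1 (hP X hX)
  exists_colimitsOfShape X := by
    obtain ⟨h⟩ := h X
    let := h.instJ
    exact ⟨h.J, inferInstance, (isCardinalFiltered_iff_mathlib _ κ).1 h.filtered,
      h.mem_colimitsOfShape⟩

lemma isCardinalLocallyPresentable_of_paper (κ : Cardinal.{v}) [Fact κ.IsRegular]
    (h : PaperAcc.IsLocallyPresentable M κ) : IsCardinalLocallyPresentable M κ := by
  obtain ⟨h₁, ι, G, hG₁, hG₂⟩ := h
  have hgen := isCardinalFilteredGenerator_of_presentations κ (Set.range G)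
    (by rintro _ ⟨i, rfl⟩; exact hG₁ i) hG₂
  have : ObjectProperty.Small.{v} (fun Y => Y ∈ Set.range G) :=
    inferInstanceAs (_root_.Small.{v} (Set.range G))
  have : HasCardinalFilteredGenerator M κ := hgen.hasCardinalFilteredGenerator
  exact { }

/-- An object is a retract of an object in `P` as soon as it is presentable and it is a
filtered colimit of objects in `P`. -/
lemma exists_retract_of_presentation (κ : Cardinal.{v}) [Fact κ.IsRegular]
    {P : Set M} {X Y : M} (h : FilteredColimitPresentation κ P X)
    [IsCardinalPresentable Y κ] (f : Y ⟶ X) :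
    ∃ (B : M) (_ : B ∈ P) (s : Y ⟶ B) (r : B ⟶ X), s ≫ r = f := by
  let := h.instJ
  have := (isCardinalFiltered_iff_mathlib _ κ).1 h.filtered
  obtain ⟨j, g, hg⟩ := IsCardinalPresentable.exists_hom_of_isColimit κ h.isColimit
    (f ≫ h.iso.inv)
  exact ⟨_, h.mem j, g, h.c.ι.app j ≫ h.iso.hom, by rw [← Category.assoc, hg]; simp⟩

end Bridges

namespace ModelStructure

variable (S : ModelStructure M)

/-- The trivial cofibrations. -/
abbrev TrivCof : MorphismProperty M := S.Cof ⊓ S.W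

/-- The trivial fibrations. -/
abbrev TrivFib : MorphismProperty M := S.Fib ⊓ S.W

lemma cof_eq_llp : S.Cof = S.TrivFib.llp := by
  ext A B f
  constructor
  · intro hf X Y p hp
    exact S.lift_cof_trivFib f p hf hp.1 hp.2
  · intro hf
    obtain ⟨Z, i, p, hi, hp, hp', fac⟩ := S.fact_cof_trivFib f
    have := hf p ⟨hp, hp'⟩
    have sq : CommSq i f p (𝟙 B) := ⟨by simpa using fac⟩
    exact S.Cof_retract f i (𝟙 A) (𝟙 A) sq.lift p (by simp) (by simp) (by simp) (by simp [fac]) hi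

lemma trivCof_eq_llp : S.TrivCof = S.Fib.llp := by
  ext A B f
  constructor
  · intro hf X Y p hp
    exact S.lift_trivCof_fib f p hf.1 hf.2 hp
  · intro hf
    obtain ⟨Z, i, p, hi, hi', hp, fac⟩ := S.fact_trivCof_fib f
    have := hf p hp
    have sq : CommSq i f p (𝟙 B) := ⟨by simpa using fac⟩
    exact ⟨S.Cof_retract f i (𝟙 A) (𝟙 A) sq.lift p (by simp) (by simp) (by simp)
      (by simp [fac]) hi, S.W_retract f i (𝟙 A) (𝟙 A) sq.lift p (by simp) (by simp) (by simp)
      (by simp [fac]) hi'⟩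

lemma fib_eq_rlp : S.Fib = S.TrivCof.rlp := by
  ext A B f
  constructor
  · intro hf X Y p hp
    exact S.lift_trivCof_fib p f hp.1 hp.2 hf
  · intro hf
    obtain ⟨Z, i, p, hi, hi', hp, fac⟩ := S.fact_trivCof_fib f
    have := hf i ⟨hi, hi'⟩
    have sq : CommSq (𝟙 A) i f p := ⟨by simpa using fac.symm⟩
    exact S.Fib_retract f p i sq.lift (𝟙 B) (𝟙 B) (by simp) (by simp) (by simp [fac])
      (by simp) hp

lemma trivFib_eq_rlp : S.TrivFib = S.Cof.rlp := by
  ext A B f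
  constructor
  · intro hf X Y p hp
    exact S.lift_cof_trivFib p f hp hf.1 hf.2
  · intro hf
    obtain ⟨Z, i, p, hi, hp, hp', fac⟩ := S.fact_cof_trivFib f
    have := hf i hi
    have sq : CommSq (𝟙 A) i f p := ⟨by simpa using fac.symm⟩
    exact ⟨S.Fib_retract f p i sq.lift (𝟙 B) (𝟙 B) (by simp) (by simp) (by simp [fac])
      (by simp) hp, S.W_retract f p i sq.lift (𝟙 B) (𝟙 B) (by simp) (by simp) (by simp [fac])
      (by simp) hp'⟩

lemma rlpOf_eq_of_cof_eq {ι : Type w} {A B : ι → M} {f : ∀ i, A i ⟶ B i}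
    (h : S.Cof = Llp (RlpOf f)) : RlpOf f = S.TrivFib := by
  rw [S.trivFib_eq_rlp, h]
  ext X Y g
  constructor
  · intro hg A B i hi
    exact hi g hg
  · intro hg i
    exact hg (f i) (fun _ _ p hp => hp i)

lemma rlpOf_eq_of_trivCof_eq {ι : Type w} {A B : ι → M} {f : ∀ i, A i ⟶ B i}
    (h : S.Cof ⊓ S.W = Llp (RlpOf f)) : RlpOf f = S.Fib := by
  rw [S.fib_eq_rlp, TrivCof, h]
  ext X Y g
  constructor
  · intro hg A B i hi
    exact hi g hg
  · intro hg i
    exact hg (f i) (fun _ _ p hp => hp i)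

instance : S.Cof.IsStableUnderCobaseChange := by rw [cof_eq_llp]; infer_instance
instance : S.Cof.IsMultiplicative := by rw [cof_eq_llp]; infer_instance
instance : S.Cof.RespectsIso := by rw [cof_eq_llp]; infer_instance
instance : S.TrivCof.IsStableUnderCobaseChange := by rw [trivCof_eq_llp]; infer_instance
instance : S.TrivCof.RespectsIso := by rw [trivCof_eq_llp]; infer_instance
instance : S.W.IsMultiplicative where
  id_mem := S.W_id
  comp_mem := S.W_comp
instance : S.W.HasTwoOutOfThreeProperty where
  comp_mem := S.W_comp
  of_postcomp := S.W_of_comp_right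
  of_precomp := S.W_of_comp_left
instance : S.W.IsStableUnderRetracts where
  of_retract {_ _ _ _ f g} r hg :=
    S.W_retract f g r.left.i r.left.r r.right.i r.right.r r.left.retract r.right.retract
      r.i.w r.r.w hg
instance : S.W.RespectsIso := inferInstance

end ModelStructure

variable {S : ModelStructure M}

lemma Cofibrant.of_cof {X Y : M} (hX : Cofibrant S X) (f : X ⟶ Y) (hf : S.Cof f) :
    Cofibrant S Y := by
  intro O hO g
  obtain rfl : hO.to X ≫ f = g := hO.hom_ext _ _
  exact S.Cof.comp_mem _ _ (hX hO _) hf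

lemma Cofibrant.of_retract {X Y : M} (hX : Cofibrant S X) (s : Y ⟶ X) (r : X ⟶ Y)
    (h : s ≫ r = 𝟙 Y) : Cofibrant S Y := by
  intro O hO g
  exact S.Cof_retract g (hO.to X) (𝟙 O) (𝟙 O) s r (by simp) h (hO.hom_ext _ _)
    (hO.hom_ext _ _) (hX hO _)

/-- A morphism with cofibrant domain which becomes a cofibration after postcomposition with
a suitable morphism. -/
def PreCof (S : ModelStructure M) {D E : M} (i : D ⟶ E) : Prop :=
  Cofibrant S D ∧ ∃ (R : M) (q : E ⟶ R), S.Cof (i ≫ q)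

namespace PreCof

lemma of_cof {D E : M} {i : D ⟶ E} (hD : Cofibrant S D) (hi : S.Cof i) : PreCof S i :=
  ⟨hD, E, 𝟙 E, by simpa⟩

lemma of_retraction {D E : M} (hD : Cofibrant S D) (i : D ⟶ E) (r : E ⟶ D) (h : i ≫ r = 𝟙 D) :
    PreCof S i :=
  ⟨hD, D, r, by rw [h]; exact S.Cof.id_mem D⟩

lemma comp [HasPushouts M] {D E F : M} {i : D ⟶ E} {j : E ⟶ F} (hi : PreCof S i)
    (hj : PreCof S j) : PreCof S (i ≫ j) := by
  obtain ⟨hD, R₁, q₁, h₁⟩ := hi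
  obtain ⟨-, R₂, q₂, h₂⟩ := hj
  refine ⟨hD, pushout q₁ (j ≫ q₂), q₂ ≫ pushout.inr _ _, ?_⟩
  have : S.Cof (pushout.inl q₁ (j ≫ q₂)) :=
    S.Cof.of_isPushout (IsPushout.of_hasPushout q₁ (j ≫ q₂)) h₂
  have h := S.Cof.comp_mem _ _ h₁ this
  rw [Category.assoc, pushout.condition] at h
  simpa using h

lemma of_isPushout [HasPushouts M] {D E X Y : M} {i : D ⟶ E} {f : D ⟶ X} {g : E ⟶ Y}
    {k : X ⟶ Y} (sq : IsPushout i f g k) (hi : PreCof S i) (hX : Cofibrant S X) :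
    PreCof S k := by
  obtain ⟨-, R, q, h⟩ := hi
  refine ⟨hX, pushout q g, pushout.inr _ _, ?_⟩
  exact S.Cof.of_isPushout (sq.paste_horiz (IsPushout.of_hasPushout q g)).flip h

end PreCof

/-- Pushouts along morphisms in `PreCof` preserve weak equivalences between cofibrant objects. -/
lemma weq_of_isPushout_of_preCof {S LS : ModelStructure M}
    (hformal : ∀ {P Q R : M} (i : P ⟶ Q) (q : Q ⟶ R), S.Cof (i ≫ q) →
      Cofibrant S P → Cofibrant S R → IsFormalCofibration S i)
    (hL₁ : LS.Cof = S.Cof) (hL₂ : S.W ≤ LS.W)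
    {D E X Y : M} {i : D ⟶ E} {w : D ⟶ X} {g : E ⟶ Y} {k : X ⟶ Y}
    (sq : IsPushout i w g k) (hi : PreCof LS i) (hX : Cofibrant LS X) (hw : LS.W w) :
    LS.W g := by
  have hcof : ∀ Z, Cofibrant LS Z ↔ Cofibrant S Z := fun Z => by
    simp only [Cofibrant, hL₁]
  obtain ⟨hD, R, q, hq⟩ := hi
  have hR : Cofibrant LS R := hD.of_cof _ hq
  rw [hcof] at hD hR hX
  obtain ⟨A', B', X', P, wA, i', wB, j, wX, pB, pX, m, hA', hwA, hi', hwB, hj, hwX, e₁, e₂,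
    sq', e₃, e₄, hm⟩ := hformal i q (by rwa [← hL₁]) hD hR w g k hX sq
  have hj' : LS.TrivCof j := by
    refine ⟨by rwa [hL₁], ?_⟩
    refine LS.W_of_comp_right j wX (hL₂ _ hwX) ?_
    rw [e₂]
    exact LS.W_comp _ _ (hL₂ _ hwA) hw
  have hpB : LS.TrivCof pB := MorphismProperty.of_isPushout sq' hj'
  refine LS.W_of_comp_left wB g (hL₂ _ hwB) ?_
  rw [← e₃]
  exact LS.W_comp _ _ hpB.2 (hL₂ _ hm)

lemma isCardinalPresentable_of_isPushout (κ : Cardinal.{v}) [Fact κ.IsRegular]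
    {A B C D : M} {f : A ⟶ B} {g : A ⟶ C} {h : B ⟶ D} {k : C ⟶ D} (sq : IsPushout f g h k)
    [IsCardinalPresentable A κ] [IsCardinalPresentable B κ] [IsCardinalPresentable C κ] :
    IsCardinalPresentable D κ := by
  have : ∀ j, IsCardinalPresentable ((span f g).obj j) κ := by
    rintro (_ | _ | _) <;> dsimp <;> infer_instance
  exact isCardinalPresentable_of_isColimit _ sq.isColimit κ
    (hasCardinalLT_of_finite _ _ (Cardinal.IsRegular.aleph0_le Fact.out))

instance (κ : Cardinal.{v}) [Fact κ.IsRegular] [HasPushouts M]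
    {A B C : M} (f : A ⟶ B) (g : A ⟶ C)
    [IsCardinalPresentable A κ] [IsCardinalPresentable B κ] [IsCardinalPresentable C κ] :
    IsCardinalPresentable (pushout f g) κ :=
  isCardinalPresentable_of_isPushout κ (IsPushout.of_hasPushout f g)

/-- The mapping cylinder factorization. -/
lemma exists_mappingCylinder [HasColimits M] (S : ModelStructure M) (κ : Cardinal.{v})
    [Fact κ.IsRegular] {X C : M} (cyl : CylinderObject S X) (hX : Cofibrant S X)
    (hC : Cofibrant S C) [IsCardinalPresentable X κ] [IsCardinalPresentable C κ]
    [IsCardinalPresentable cyl.C κ] (g : X ⟶ C) :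
    ∃ (N : M) (_ : IsCardinalPresentable N κ) (i : X ⟶ N) (p : N ⟶ C),
      S.Cof i ∧ S.W p ∧ i ≫ p = g := by
  have hinl : ∀ {A C : M}, Cofibrant S C → S.Cof (coprod.inl : A ⟶ A ⨿ C) := fun {A C} h =>
    MorphismProperty.of_isPushout (P := S.Cof)
      (IsPushout.of_hasBinaryCoproduct' A C) (h initialIsInitial _)
  have hinr : ∀ {A C : M}, Cofibrant S A → S.Cof (coprod.inr : C ⟶ A ⨿ C) := fun {A C} h =>
    MorphismProperty.of_isPushout (P := S.Cof)
      (IsPushout.of_hasBinaryCoproduct' A C).flip (h initialIsInitial _)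
  have hd : S.Cof (coprod.desc cyl.i₁ cyl.i₀) := by
    have h := cyl.hcof _ (coprodIsCoprod X X)
    have : coprod.desc cyl.i₁ cyl.i₀ = (coprod.braiding X X).hom ≫
        (coprodIsCoprod X X).desc (BinaryCofan.mk cyl.i₀ cyl.i₁) := by
      have h₁ := (coprodIsCoprod X X).fac (BinaryCofan.mk cyl.i₀ cyl.i₁) ⟨WalkingPair.left⟩
      have h₂ := (coprodIsCoprod X X).fac (BinaryCofan.mk cyl.i₀ cyl.i₁) ⟨WalkingPair.right⟩
      dsimp at h₁ h₂
      ext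
      · exact (coprod.inl_desc _ _).trans ((coprod.inl_desc_assoc _ _ _).trans h₂).symm
      · exact (coprod.inr_desc _ _).trans ((coprod.inr_desc_assoc _ _ _).trans h₁).symm
    rw [this]
    exact (MorphismProperty.cancel_left_of_respectsIso _ _ _).2 h
  have hi₁ : S.TrivCof cyl.i₁ := by
    constructor
    · have h := S.Cof.comp_mem _ _ (hinl (A := X) hX) hd
      simpa [coprod.inl_desc] using h
    · exact S.W_of_comp_right _ cyl.p cyl.hp (by rw [cyl.hi₁]; exact S.W_id _)
  have sq := IsPushout.of_hasPushout cyl.i₁ g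
  have hinr' : S.TrivCof (pushout.inr cyl.i₁ g) := MorphismProperty.of_isPushout sq.flip hi₁
  have sq₁ : IsPushout (coprod.inl : X ⟶ X ⨿ X) g (coprod.map g (𝟙 X)) coprod.inl :=
    IsPushout.of_coprod_inl_with_id g X
  have sq₂ : IsPushout (coprod.desc cyl.i₁ cyl.i₀) (coprod.map g (𝟙 X)) (pushout.inl cyl.i₁ g)
      (coprod.desc (pushout.inr cyl.i₁ g) (cyl.i₀ ≫ pushout.inl cyl.i₁ g)) := by
    refine IsPushout.of_left (h₁₁ := coprod.inl) (v₁₁ := g) (h₂₁ := coprod.inl) ?_ ?_ sq₁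
    · simpa [coprod.inl_desc] using sq
    · ext <;> simp [coprod.inl_desc, coprod.inr_desc, pushout.condition]
  refine ⟨pushout cyl.i₁ g, inferInstance, cyl.i₀ ≫ pushout.inl _ _,
    pushout.desc (cyl.p ≫ g) (𝟙 C) (by rw [← Category.assoc, cyl.hi₁]; simp), ?_, ?_, ?_⟩
  · have h := S.Cof.comp_mem _ _ (hinr hC) (MorphismProperty.of_isPushout sq₂.flip hd)
    simpa [coprod.inr_desc] using h
  · refine S.W_of_comp_left (pushout.inr cyl.i₁ g) _ hinr'.2 ?_
    simpa [pushout.inr_desc] using S.W_id C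
  · rw [Category.assoc, pushout.inl_desc, ← Category.assoc, cyl.hi₀, Category.id_comp]

/-- The properties of a model structure which allow to approximate weak equivalences by
weak equivalences between `κ`-presentable objects. -/
structure HasPresentableFactorizations (S : ModelStructure M) (κ : Cardinal.{v})
    [Fact κ.IsRegular] : Prop where
  cofibrant (X : M) [IsCardinalPresentable X κ] : Cofibrant S X
  weq_pushout {D E X Y : M} {i : D ⟶ E} {w : D ⟶ X} {g : E ⟶ Y} {k : X ⟶ Y} :
    IsPushout i w g k → PreCof S i → Cofibrant S X → S.W w → S.W g
  exists_cof_weq {K Z : M} [IsCardinalPresentable K κ] (f : K ⟶ Z) :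
    ∃ (B : M) (_ : IsCardinalPresentable B κ) (s : K ⟶ B) (r : B ⟶ Z), s ≫ r = f ∧
      ∀ {C : M} [IsCardinalPresentable C κ] (g : B ⟶ C),
        ∃ (N : M) (_ : IsCardinalPresentable N κ) (i : B ⟶ N) (p : N ⟶ C),
          S.Cof i ∧ S.W p ∧ i ≫ p = g

lemma HasPresentableFactorizations.exists_preCof_weq [HasPushouts M]
    {S : ModelStructure M} {κ : Cardinal.{v}}
    [Fact κ.IsRegular] (h : HasPresentableFactorizations S κ) {D C : M}
    [IsCardinalPresentable D κ] [IsCardinalPresentable C κ] (g : D ⟶ C) :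
    ∃ (N : M) (_ : IsCardinalPresentable N κ) (i : D ⟶ N) (p : N ⟶ C),
      PreCof S i ∧ S.W p ∧ i ≫ p = g := by
  obtain ⟨B, _, s, r, hsr, hB⟩ := h.exists_cof_weq (𝟙 D)
  obtain ⟨N, _, i, p, hi, hp, fac⟩ := hB (r ≫ g)
  exact ⟨N, inferInstance, s ≫ i, p, (PreCof.of_retraction (h.cofibrant D) s r hsr).comp
    (PreCof.of_cof (h.cofibrant B) hi), hp, by
      rw [Category.assoc, fac, ← Category.assoc, hsr, Category.id_comp]⟩

lemma hasPresentableFactorizations (S LS : ModelStructure M) (κ : Cardinal.{v})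
    [Fact κ.IsRegular] [HasColimits M]
    (hformal : ∀ {P Q R : M} (i : P ⟶ Q) (q : Q ⟶ R), S.Cof (i ≫ q) →
      Cofibrant S P → Cofibrant S R → IsFormalCofibration S i)
    (hL₁ : LS.Cof = S.Cof) (hL₂ : S.W ≤ LS.W) (B : Set M)
    (hB₁ : ∀ X ∈ B, PaperAcc.IsPresentable κ X ∧ Cofibrant LS X)
    (hB₂ : ∀ X : M, Nonempty (FilteredColimitPresentation κ B X))
    (hBcyl : ∀ X ∈ B, ∃ cyl : CylinderObject LS X, PaperAcc.IsPresentable κ cyl.C) :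
    HasPresentableFactorizations LS κ := by
  have hcof : ∀ (X : M) [IsCardinalPresentable X κ], Cofibrant LS X := fun X _ => by
    obtain ⟨B, hB, s, r, hsr⟩ := exists_retract_of_presentation κ (hB₂ X).some (𝟙 X)
    exact (hB₁ B hB).2.of_retract s r hsr
  refine ⟨hcof, fun sq hi hX hw => weq_of_isPushout_of_preCof hformal hL₁ hL₂ sq hi hX hw, ?_⟩
  intro K Z _ f
  obtain ⟨B, hB, s, r, hsr⟩ := exists_retract_of_presentation κ (hB₂ Z).some f
  have hpres := (isPresentable_iff_mathlib κ B).1 (hB₁ B hB).1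
  refine ⟨B, hpres, s, r, hsr, fun {C} _ g => ?_⟩
  obtain ⟨cyl, hcyl⟩ := hBcyl B hB
  have := (isPresentable_iff_mathlib κ _).1 hcyl
  exact exists_mappingCylinder LS κ cyl (hB₁ B hB).2 (hcof C) g

/-- A morphism is approximable if every morphism to it from an arrow between `κ`-presentable
objects factors through a weak equivalence between `κ`-presentable objects. -/
def Approximable (S : ModelStructure M) (κ : Cardinal.{v}) [Fact κ.IsRegular]
    {X Y : M} (f : X ⟶ Y) : Prop :=
  ∀ ⦃K L : M⦄ [IsCardinalPresentable K κ] [IsCardinalPresentable L κ] (a : K ⟶ L)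
    (u : K ⟶ X) (v : L ⟶ Y), u ≫ f = a ≫ v →
    ∃ (K' L' : M) (_ : IsCardinalPresentable K' κ) (_ : IsCardinalPresentable L' κ)
      (w : K' ⟶ L') (s : K ⟶ K') (t : L ⟶ L') (u' : K' ⟶ X) (v' : L' ⟶ Y),
      S.W w ∧ a ≫ t = s ≫ w ∧ u' ≫ f = w ≫ v' ∧ s ≫ u' = u ∧ t ≫ v' = v

section

variable {S : ModelStructure M} {κ : Cardinal.{v}} [Fact κ.IsRegular] [HasPushouts M]

lemma HasPresentableFactorizations.approximable_of_trivFib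
    (h : HasPresentableFactorizations S κ) {X Y : M} {f : X ⟶ Y} (hf : S.TrivFib f) :
    Approximable S κ f := by
  intro K L _ _ a u v e
  obtain ⟨B, _, s, r, hsr, hB⟩ := h.exists_cof_weq u
  obtain ⟨N, _, i, p, hi, hp, fac⟩ := hB (pushout.inr a s)
  have := S.lift_cof_trivFib i f hi hf.1 hf.2
  let d : pushout a s ⟶ Y := pushout.desc v (r ≫ f) (by rw [← e, ← Category.assoc, hsr])
  have sq : CommSq r i f (p ≫ d) := ⟨by rw [← Category.assoc, fac, pushout.inr_desc]⟩
  exact ⟨N, _, inferInstance, inferInstance, p, s ≫ i, pushout.inl a s, sq.lift, d, hp,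
    by rw [Category.assoc, fac, pushout.condition], by simp, by simp [hsr], pushout.inl_desc _ _ _⟩

lemma Approximable.comp (h : HasPresentableFactorizations S κ) {X Z Y : M} {f : X ⟶ Z}
    {g : Z ⟶ Y} (hf : Approximable S κ f) (hg : Approximable S κ g) :
    Approximable S κ (f ≫ g) := by
  intro K L _ _ a u v e
  obtain ⟨C, L', _, _, w, c, t, z, y, hw, e₁, e₂, e₃, e₄⟩ := hg a (u ≫ f) v (by simpa using e)
  obtain ⟨K₁, C₁, _, _, w₁, s₁, t₁, x₁, z₁, hw₁, e₅, e₆, e₇, e₈⟩ := hf c u z e₃.symm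
  obtain ⟨K', _, i, p, hi, hp, fac⟩ := h.exists_preCof_weq s₁
  have sq := IsPushout.of_hasPushout i c
  obtain ⟨E, _, j, q, hj, hq, fac'⟩ := h.exists_preCof_weq
    (pushout.desc (p ≫ w₁) t₁ (by rw [← Category.assoc, fac, e₅]) : pushout i c ⟶ C₁)
  have hC : PreCof S (pushout.inr i c ≫ j) :=
    (PreCof.of_isPushout sq hi (h.cofibrant C)).comp hj
  have sq' := IsPushout.of_hasPushout (pushout.inr i c ≫ j) w
  have hE := h.weq_pushout sq' hC (h.cofibrant L') hw
  have fl := congr_arg (fun φ => pushout.inl i c ≫ φ) fac'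
  have fr := congr_arg (fun φ => pushout.inr i c ≫ φ) fac'
  simp only [pushout.inl_desc, pushout.inr_desc] at fl fr
  have hKE : S.W (pushout.inl i c ≫ j) := by
    refine S.W_of_comp_right _ q hq ?_
    rw [Category.assoc, fl]
    exact S.W_comp _ _ hp hw₁
  refine ⟨K', _, inferInstance, inferInstance,
    (pushout.inl i c ≫ j) ≫ pushout.inl (pushout.inr i c ≫ j) w, i,
    t ≫ pushout.inr (pushout.inr i c ≫ j) w, p ≫ x₁,
    pushout.desc (q ≫ z₁ ≫ g) y ?_, S.W_comp _ _ hKE hE, ?_, ?_, ?_, ?_⟩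
  · rw [← e₂, ← e₈]
    simp only [Category.assoc] at fr ⊢
    rw [reassoc_of% fr]
  · rw [reassoc_of% e₁, ← pushout.condition (f := pushout.inr i c ≫ j)]
    simp only [← Category.assoc, pushout.condition (f := i)]
  · simp only [Category.assoc, pushout.inl_desc] at fl ⊢
    rw [reassoc_of% fl, reassoc_of% e₆]
  · rw [reassoc_of% fac, e₇]
  · rw [Category.assoc, pushout.inr_desc, e₄]

end

lemma exists_square_of_isColimit (κ : Cardinal.{v}) [Fact κ.IsRegular]
    {J : Type v} [SmallCategory J] [CategoryTheory.IsCardinalFiltered J κ]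
    {F G : J ⥤ M} {cF : Cocone F} {cG : Cocone G} (hF : IsColimit cF) (hG : IsColimit cG)
    (φ : F ⟶ G) (g : cF.pt ⟶ cG.pt) (hg : ∀ j, cF.ι.app j ≫ g = φ.app j ≫ cG.ι.app j)
    {K L : M} [IsCardinalPresentable K κ] [IsCardinalPresentable L κ] (a : K ⟶ L)
    (u : K ⟶ cF.pt) (v : L ⟶ cG.pt) (w : u ≫ g = a ≫ v) :
    ∃ (j : J) (u' : K ⟶ F.obj j) (v' : L ⟶ G.obj j), u' ≫ φ.app j = a ≫ v' ∧
      u' ≫ cF.ι.app j = u ∧ v' ≫ cG.ι.app j = v := by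
  have := isFiltered_of_isCardinalFiltered J κ
  obtain ⟨j₁, u₁, rfl⟩ := IsCardinalPresentable.exists_hom_of_isColimit κ hF u
  obtain ⟨j₂, v₂, rfl⟩ := IsCardinalPresentable.exists_hom_of_isColimit κ hG v
  let j₀ := IsFiltered.max j₁ j₂
  obtain ⟨j, t, ht⟩ := IsCardinalPresentable.exists_eq_of_isColimit' κ hG
    (u₁ ≫ F.map (IsFiltered.leftToMax j₁ j₂) ≫ φ.app j₀)
    (a ≫ v₂ ≫ G.map (IsFiltered.rightToMax j₁ j₂)) (by simpa [hg, j₀] using w)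
  refine ⟨j, u₁ ≫ F.map (IsFiltered.leftToMax j₁ j₂ ≫ t),
    v₂ ≫ G.map (IsFiltered.rightToMax j₁ j₂ ≫ t), ?_, by simp, by simp⟩
  simpa [j₀] using ht

section FunctorFactorization

variable {S : ModelStructure M} {ι : Type v} {A B : ι → M} (f : ∀ i, A i ⟶ B i)
  (J : Type v) [SmallCategory J] [HasColimits M]

/-- The free morphisms of diagrams attached to the morphisms of a family `f`. -/
abbrev freeHoms : MorphismProperty (J ⥤ M) :=
  MorphismProperty.ofHoms
    (fun (x : ι × J) => (evaluationLeftAdjoint M x.2).map (f x.1))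

lemma freeHoms_rlp_iff {X Y : J ⥤ M} (p : X ⟶ Y) :
    (freeHoms f J).rlp p ↔ ∀ j, RlpOf f (p.app j) := by
  constructor
  · intro h j i
    exact ((evaluationAdjunctionRight M j).hasLiftingProperty_iff _ _).1
      (h _ (⟨(i, j)⟩))
  · rintro h _ _ _ ⟨⟨i, j⟩⟩
    exact ((evaluationAdjunctionRight M j).hasLiftingProperty_iff _ _).2 (h j i)

lemma trivCof_functorCategory_freeHoms (hf : S.TrivCof = Llp (RlpOf f)) :
    freeHoms f J ≤ S.TrivCof.functorCategory J := by
  rintro _ _ _ ⟨⟨i, j⟩⟩ k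
  have hi : S.Fib.llp (f i) := by
    rw [← S.trivCof_eq_llp, hf]
    intro _ _ p hp
    exact hp i
  rw [S.trivCof_eq_llp]
  have h : S.Fib.llp (Limits.Sigma.map (fun _ : j ⟶ k => f i)) :=
    MorphismProperty.colimMap _ (fun _ => hi)
  have e : ((evaluationLeftAdjoint M j).map (f i)).app k =
      Limits.Sigma.map (fun _ : j ⟶ k => f i) :=
    Limits.Sigma.hom_ext _ _ (fun g => by simp [evaluationLeftAdjoint])
  exact e ▸ h

lemma trivCof_functorCategory_coproducts_pushouts (hf : S.TrivCof = Llp (RlpOf f)) :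
    (MorphismProperty.coproducts.{v} (freeHoms f J)).pushouts ≤ S.TrivCof.functorCategory J := by
  have h := trivCof_functorCategory_freeHoms f J hf
  rw [S.trivCof_eq_llp] at h ⊢
  have : MorphismProperty.IsStableUnderCoproducts.{v} (S.Fib.llp.functorCategory J) := { }
  rw [MorphismProperty.pushouts_le_iff]
  exact (MorphismProperty.coproducts_monotone h).trans (MorphismProperty.coproducts_le _)

/-- Small object argument in a category of diagrams. -/
lemma exists_factorization_functor (κ : Cardinal.{v}) [Fact κ.IsRegular]
    [∀ i, IsCardinalPresentable (A i) κ] (hf : S.TrivCof = Llp (RlpOf f))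
    {X Y : J ⥤ M} (φ : X ⟶ Y) :
    ∃ (Z : J ⥤ M) (i : X ⟶ Z) (p : Z ⟶ Y), i ≫ p = φ ∧ (freeHoms f J).rlp.llp i ∧
      (∀ j, S.TrivCof (i.app j)) ∧ ∀ j, S.Fib (p.app j) := by
  have : Nonempty κ.ord.ToType := by simpa using Cardinal.IsRegular.ne_zero Fact.out
  let := WellFoundedLT.toOrderBot κ.ord.ToType
  have : (freeHoms f J).IsCardinalForSmallObjectArgument κ :=
    { preservesColimit := by
        rintro _ _ _ _ _ ⟨⟨i, j⟩⟩ g hg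
        have := preservesColimitsOfShape_of_isCardinalPresentable (A i) κ κ.ord.ToType
        have : PreservesColimit hg.F ((evaluation J M).obj j ⋙
            coyoneda.obj (Opposite.op (A i))) := inferInstance
        let e : (evaluation J M).obj j ⋙ coyoneda.obj (Opposite.op (A i)) ≅
            coyoneda.obj (Opposite.op ((evaluationLeftAdjoint M j).obj (A i))) :=
          NatIso.ofComponents
            (fun F => ((evaluationAdjunctionRight M j).homEquiv _ _).symm.toIso)
            (fun {F G} g => by
              ext x
              exact (evaluationAdjunctionRight M j).homEquiv_naturality_right_symm _ _)
        exact preservesColimit_of_natIso _ e }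
  refine ⟨_, SmallObject.ιObj (freeHoms f J) κ φ, SmallObject.πObj (freeHoms f J) κ φ,
    by simp, SmallObject.llp_rlp_ιObj _ _ _, ?_, ?_⟩
  · have h₁ := trivCof_functorCategory_coproducts_pushouts f J hf
    have h₂ := SmallObject.transfiniteCompositionsOfShape_ιObj (freeHoms f J) κ φ
    have h₃ := MorphismProperty.transfiniteCompositionsOfShape_monotone _ h₁ _ h₂
    rw [S.trivCof_eq_llp] at h₃ ⊢
    exact MorphismProperty.transfiniteCompositionsOfShape_le _ _ _ h₃
  · rw [← S.rlpOf_eq_of_trivCof_eq hf]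
    exact (freeHoms_rlp_iff f J _).1 (SmallObject.rlp_πObj _ _ _)

lemma weq_colimMap (κ : Cardinal.{v}) [Fact κ.IsRegular] [CategoryTheory.IsCardinalFiltered J κ]
    [∀ i, IsCardinalPresentable (A i) κ] (hf : S.TrivCof = Llp (RlpOf f))
    {ι' : Type v} {A' B' : ι' → M} (f' : ∀ i, A' i ⟶ B' i)
    [∀ i, IsCardinalPresentable (A' i) κ] [∀ i, IsCardinalPresentable (B' i) κ]
    (hf' : S.Cof = Llp (RlpOf f'))
    {X Y : J ⥤ M} {φ : X ⟶ Y} (hφ : ∀ j, S.W (φ.app j)) :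
    S.W (colimMap φ) := by
  obtain ⟨Z, i, p, rfl, hi, hi', hp⟩ := exists_factorization_functor f J κ hf φ
  have hp' (j : J) : S.TrivFib (p.app j) :=
    ⟨hp j, S.W_of_comp_left (i.app j) _ (hi' j).2 (hφ j)⟩
  have h₁ : S.TrivCof (colim.map i) := by
    rw [S.trivCof_eq_llp]
    intro _ _ q hq
    refine (colimConstAdj.hasLiftingProperty_iff _ _).2 (hi _ ?_)
    rw [freeHoms_rlp_iff, S.rlpOf_eq_of_trivCof_eq hf]
    exact fun _ => hq
  have h₂ : S.TrivFib (colim.map p) := by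
    rw [← S.rlpOf_eq_of_cof_eq hf'] at hp' ⊢
    intro k
    refine ⟨fun {a b} sq => ?_⟩
    obtain ⟨j, a', b', w, rfl, rfl⟩ := exists_square_of_isColimit κ (colimit.isColimit Z)
      (colimit.isColimit Y) p (colim.map p) (by simp) _ a b sq.w
    have := hp' j k
    have sq' : CommSq a' (f' k) (p.app j) b' := ⟨w⟩
    exact ⟨⟨⟨sq'.lift ≫ colimit.ι Z j, by simp, by simp⟩⟩⟩
  have h₃ := S.W_comp _ _ h₁.2 h₂.2
  rw [← Functor.map_comp] at h₃
  exact h₃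

/-- Weak equivalences are closed under `κ`-filtered colimits. -/
lemma weq_of_isColimit (κ : Cardinal.{v}) [Fact κ.IsRegular] (h : IsCombinatorial S κ)
    {J : Type v} [SmallCategory J] [CategoryTheory.IsCardinalFiltered J κ]
    {X Y : J ⥤ M} {cX : Cocone X} {cY : Cocone Y} (hX : IsColimit cX) (hY : IsColimit cY)
    (φ : X ⟶ Y) (g : cX.pt ⟶ cY.pt) (hg : ∀ j, cX.ι.app j ≫ g = φ.app j ≫ cY.ι.app j)
    (hφ : ∀ j, S.W (φ.app j)) : S.W g := by
  obtain ⟨ι, A, B, f, hA, hB, hf⟩ := h.trivCofGenerated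
  obtain ⟨ι', A', B', f', hA', hB', hf'⟩ := h.cofGenerated
  simp only [isPresentable_iff_mathlib] at hA hB hA' hB'
  have e : Arrow.mk (colimMap φ) ≅ Arrow.mk g :=
    Arrow.isoMk ((colimit.isColimit X).coconePointUniqueUpToIso hX)
      ((colimit.isColimit Y).coconePointUniqueUpToIso hY)
      (by
        dsimp
        ext j
        simp [hg])
  exact (S.W.arrow_mk_iso_iff e).1 (weq_colimMap f J κ hf f' hf' hφ)

end FunctorFactorization

lemma Approximable.of_isColimit {S : ModelStructure M} {κ : Cardinal.{v}} [Fact κ.IsRegular]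
    {J : Type v} [SmallCategory J] [CategoryTheory.IsCardinalFiltered J κ]
    {X Y : J ⥤ M} {cX : Cocone X} {cY : Cocone Y} (hX : IsColimit cX) (hY : IsColimit cY)
    (φ : X ⟶ Y) (g : cX.pt ⟶ cY.pt) (hg : ∀ j, cX.ι.app j ≫ g = φ.app j ≫ cY.ι.app j)
    (hφ : ∀ j, S.W (φ.app j)) [∀ j, IsCardinalPresentable (X.obj j) κ]
    [∀ j, IsCardinalPresentable (Y.obj j) κ] : Approximable S κ g := by
  intro K L _ _ a u v w
  obtain ⟨j, u', v', w', hu', hv'⟩ := exists_square_of_isColimit κ hX hY φ g hg a u v w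
  exact ⟨_, _, inferInstance, inferInstance, φ.app j, u', v', cX.ι.app j, cY.ι.app j, hφ j,
    w'.symm, hg j, hu', hv'⟩


lemma isCardinalPresentable_coequalizer {κ : Cardinal.{v}} [Fact κ.IsRegular] [HasColimits M]
    {X Y : M} (f g : X ⟶ Y) [IsCardinalPresentable X κ] [IsCardinalPresentable Y κ] :
    IsCardinalPresentable (coequalizer f g) κ := by
  have (j : WalkingParallelPair) : IsCardinalPresentable ((parallelPair f g).obj j) κ := by
    cases j <;> assumption
  exact isCardinalPresentable_of_isColimit _ (colimit.isColimit (parallelPair f g)) κ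
    (hasCardinalLT_of_finite _ _ (Cardinal.IsRegular.aleph0_le Fact.out))

lemma isCardinalPresentable_initial (κ : Cardinal.{v}) [Fact κ.IsRegular] [HasColimits M] :
    IsCardinalPresentable (⊥_ M) κ := by
  have (j : Discrete PEmpty.{1}) : IsCardinalPresentable ((Functor.empty M).obj j) κ :=
    j.as.elim
  exact isCardinalPresentable_of_isColimit _ (colimit.isColimit (Functor.empty M)) κ
    (hasCardinalLT_of_finite _ _ (Cardinal.IsRegular.aleph0_le Fact.out))

/-- A weak equivalence between objects in the image of `g` that is equipped with a
morphism to `f`. -/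
structure Approximation {G : Type v} [SmallCategory G] (g : G ⥤ M) (S : ModelStructure M)
    {X Y : M} (f : X ⟶ Y) where
  /-- the source -/
  src : G
  /-- the target -/
  tgt : G
  /-- the weak equivalence -/
  w : g.obj src ⟶ g.obj tgt
  weq : S.W w
  /-- the morphism from the source -/
  u : g.obj src ⟶ X
  /-- the morphism from the target -/
  v : g.obj tgt ⟶ Y
  comm : u ≫ f = w ≫ v

namespace Approximation

variable {G : Type v} [SmallCategory G] {g : G ⥤ M} {S : ModelStructure M} {X Y : M} {f : X ⟶ Y}

/-- Morphisms of approximations. -/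
@[ext]
structure Hom (c c' : Approximation g S f) where
  /-- the morphism between the sources -/
  left : c.src ⟶ c'.src
  /-- the morphism between the targets -/
  right : c.tgt ⟶ c'.tgt
  comm : g.map left ≫ c'.w = c.w ≫ g.map right
  map_u : g.map left ≫ c'.u = c.u
  map_v : g.map right ≫ c'.v = c.v

attribute [local simp] Hom.comm Hom.map_u Hom.map_v

@[simps]
instance : SmallCategory (Approximation g S f) where
  Hom := Hom
  id c := { left := 𝟙 _, right := 𝟙 _, comm := by simp, map_u := by simp, map_v := by simp }
  comp φ ψ :=
    { left := φ.left ≫ ψ.left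
      right := φ.right ≫ ψ.right
      comm := by simp [Hom.comm, ← reassoc_of% φ.comm]
      map_u := by simp
      map_v := by simp }

@[ext]
lemma hom_ext {c c' : Approximation g S f} {φ ψ : c ⟶ c'} (h₁ : φ.left = ψ.left)
    (h₂ : φ.right = ψ.right) : φ = ψ := Hom.ext h₁ h₂

/-- The functor sending an approximation to its source. -/
@[simps]
def toLeft : Approximation g S f ⥤ CostructuredArrow g X where
  obj c := CostructuredArrow.mk c.u
  map φ := CostructuredArrow.homMk φ.left φ.map_u

/-- The functor sending an approximation to its target. -/
@[simps]
def toRight : Approximation g S f ⥤ CostructuredArrow g Y where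
  obj c := CostructuredArrow.mk c.v
  map φ := CostructuredArrow.homMk φ.right φ.map_v

/-- The functor sending an approximation to the underlying weak equivalence. -/
@[simps]
def toArrow : Approximation g S f ⥤ Arrow M where
  obj c := Arrow.mk c.w
  map φ := Arrow.homMk (g.map φ.left) (g.map φ.right) φ.comm

/-- The source of an approximation, as an object of `M`. -/
@[simps]
def srcFunctor : Approximation g S f ⥤ M where
  obj c := g.obj c.src
  map φ := g.map φ.left

/-- The target of an approximation, as an object of `M`. -/
@[simps]
def tgtFunctor : Approximation g S f ⥤ M where
  obj c := g.obj c.tgt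
  map φ := g.map φ.right

/-- The weak equivalence of an approximation, as a natural transformation. -/
@[simps]
def toW : (srcFunctor : Approximation g S f ⥤ M) ⟶ tgtFunctor where
  app c := c.w
  naturality _ _ φ := φ.comm

/-- The sources of approximations of `f : X ⟶ Y` map to `X`. -/
@[simps]
def toX : (srcFunctor : Approximation g S f ⥤ M) ⟶ (Functor.const _).obj X where
  app c := c.u
  naturality _ _ φ := φ.map_u.trans (Category.comp_id _).symm

/-- The targets of approximations of `f : X ⟶ Y` map to `Y`. -/
@[simps]
def toY : (tgtFunctor : Approximation g S f ⥤ M) ⟶ (Functor.const _).obj Y where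
  app c := c.v
  naturality _ _ φ := φ.map_v.trans (Category.comp_id _).symm

section

variable [g.Full]

/-- Constructor for morphisms of approximations. -/
noncomputable def homMk {c c' : Approximation g S f} (s : g.obj c.src ⟶ g.obj c'.src)
    (t : g.obj c.tgt ⟶ g.obj c'.tgt) (h : s ≫ c'.w = c.w ≫ t) (hs : s ≫ c'.u = c.u)
    (ht : t ≫ c'.v = c.v) : c ⟶ c' :=
  { left := g.preimage s
    right := g.preimage t
    comm := by simpa using h
    map_u := by simpa using hs
    map_v := by simpa using ht }

@[simp]
lemma map_homMk_left {c c' : Approximation g S f} (s : g.obj c.src ⟶ g.obj c'.src)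
    (t : g.obj c.tgt ⟶ g.obj c'.tgt) (h hs ht) :
    g.map (homMk s t h hs ht : c ⟶ c').left = s := by
  simp [homMk]

@[simp]
lemma map_homMk_right {c c' : Approximation g S f} (s : g.obj c.src ⟶ g.obj c'.src)
    (t : g.obj c.tgt ⟶ g.obj c'.tgt) (h hs ht) :
    g.map (homMk s t h hs ht : c ⟶ c').right = t := by
  simp [homMk]

end

lemma nonempty_cocone_of_app [g.Full] [g.Faithful] {A : Type*} [Category* A]
    (F : A ⥤ Approximation g S f) (c : Approximation g S f)
    (s : ∀ j, g.obj (F.obj j).src ⟶ g.obj c.src) (t : ∀ j, g.obj (F.obj j).tgt ⟶ g.obj c.tgt)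
    (h : ∀ j, s j ≫ c.w = (F.obj j).w ≫ t j) (hs : ∀ j, s j ≫ c.u = (F.obj j).u)
    (ht : ∀ j, t j ≫ c.v = (F.obj j).v)
    (nat_s : ∀ {j j'} (φ : j ⟶ j'), g.map (F.map φ).left ≫ s j' = s j)
    (nat_t : ∀ {j j'} (φ : j ⟶ j'), g.map (F.map φ).right ≫ t j' = t j) :
    Nonempty (Cocone F) :=
  ⟨Cocone.mk c
    { app j := homMk (s j) (t j) (h j) (hs j) (ht j)
      naturality j j' φ := by
        refine Eq.trans ?_ (Category.comp_id _).symm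
        apply hom_ext
        · apply g.map_injective
          refine (g.map_comp _ _).trans ?_
          rw [map_homMk_left, map_homMk_left, nat_s]
        · apply g.map_injective
          refine (g.map_comp _ _).trans ?_
          rw [map_homMk_right, map_homMk_right, nat_t] }⟩

variable {κ : Cardinal.{v}} [Fact κ.IsRegular]

lemma exists_of_approximable
    (hg : ∀ (K : M) [IsCardinalPresentable K κ], ∃ K', Nonempty (K ≅ g.obj K'))
    (hf : Approximable S κ f)
    {K L : M} [IsCardinalPresentable K κ] [IsCardinalPresentable L κ] (a : K ⟶ L)
    (u : K ⟶ X) (v : L ⟶ Y) (h : u ≫ f = a ≫ v) :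
    ∃ (c : Approximation g S f) (s : K ⟶ g.obj c.src)
      (t : L ⟶ g.obj c.tgt), a ≫ t = s ≫ c.w ∧ s ≫ c.u = u ∧ t ≫ c.v = v := by
  obtain ⟨K', L', _, _, w, s, t, u', v', hw, h₁, h₂, h₃, h₄⟩ := hf a u v h
  obtain ⟨K'', ⟨eK⟩⟩ := hg K'
  obtain ⟨L'', ⟨eL⟩⟩ := hg L'
  exact ⟨{
    src := K''
    tgt := L''
    w := eK.inv ≫ w ≫ eL.hom
    weq := by rwa [MorphismProperty.cancel_left_of_respectsIso S.W,
      MorphismProperty.cancel_right_of_respectsIso S.W]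
    u := eK.inv ≫ u'
    v := eL.inv ≫ v'
    comm := by simp [h₂] }, s ≫ eK.hom, t ≫ eL.hom, by simp [reassoc_of% h₁], by simpa,
    by simpa⟩

variable [HasColimits M] [∀ K, IsCardinalPresentable (g.obj K) κ] [g.Full]

lemma isCardinalFiltered [g.Faithful]
    (hg : ∀ (K : M) [IsCardinalPresentable K κ], ∃ K', Nonempty (K ≅ g.obj K'))
    (hf : Approximable S κ f) :
    CategoryTheory.IsCardinalFiltered (Approximation g S f) κ where
  nonempty_cocone {A} _ F hA := by
    let FL : A ⥤ M := F ⋙ srcFunctor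
    let FR : A ⥤ M := F ⋙ tgtFunctor
    have hFL (j : A) : IsCardinalPresentable (FL.obj j) κ :=
      inferInstanceAs (IsCardinalPresentable (g.obj _) κ)
    have hFR (j : A) : IsCardinalPresentable (FR.obj j) κ :=
      inferInstanceAs (IsCardinalPresentable (g.obj _) κ)
    have : IsCardinalPresentable (colimit FL) κ :=
      isCardinalPresentable_of_isColimit _ (colimit.isColimit FL) κ hA
    have : IsCardinalPresentable (colimit FR) κ :=
      isCardinalPresentable_of_isColimit _ (colimit.isColimit FR) κ hA
    obtain ⟨c, s, t, h₁, h₂, h₃⟩ := exists_of_approximable hg hf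
      (colimMap (Functor.whiskerLeft F (toW (S := S) (f := f))))
      (colimit.desc FL ((Cocone.mk X toX).whisker F))
      (colimit.desc FR ((Cocone.mk Y toY).whisker F))
      (by
        ext j
        simp only [FL, FR, colimit.ι_desc_assoc, ι_colimMap_assoc, colimit.ι_desc]
        exact (F.obj j).comm)
    have hs (j : A) : colimit.ι FL j ≫ s ≫ c.w = (F.obj j).w ≫ colimit.ι FR j ≫ t := by
      rw [← h₁, ι_colimMap_assoc]
      rfl
    have hu (j : A) : colimit.ι FL j ≫ s ≫ c.u = (F.obj j).u := by
      rw [h₂, colimit.ι_desc]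
      rfl
    have hv (j : A) : colimit.ι FR j ≫ t ≫ c.v = (F.obj j).v := by
      rw [h₃, colimit.ι_desc]
      rfl
    have nat_s {j j' : A} (φ : j ⟶ j') :
        g.map (F.map φ).left ≫ colimit.ι FL j' ≫ s = colimit.ι FL j ≫ s :=
      colimit.w_assoc FL φ s
    have nat_t {j j' : A} (φ : j ⟶ j') :
        g.map (F.map φ).right ≫ colimit.ι FR j' ≫ t = colimit.ι FR j ≫ t :=
      colimit.w_assoc FR φ t
    exact nonempty_cocone_of_app F c (fun j => colimit.ι FL j ≫ s) (fun j => colimit.ι FR j ≫ t)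
      (fun j => (Category.assoc _ _ _).trans (hs j)) (fun j => (Category.assoc _ _ _).trans (hu j))
      (fun j => (Category.assoc _ _ _).trans (hv j)) nat_s nat_t

lemma exists_coequalizing_left
    (hg : ∀ (K : M) [IsCardinalPresentable K κ], ∃ K', Nonempty (K ≅ g.obj K'))
    (hf : Approximable S κ f) (c : Approximation g S f) {K : M} [IsCardinalPresentable K κ]
    (a b : K ⟶ g.obj c.src) (hab : a ≫ c.u = b ≫ c.u) :
    ∃ (c' : Approximation g S f) (φ : c ⟶ c'), a ≫ g.map φ.left = b ≫ g.map φ.left := by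
  have := isCardinalPresentable_coequalizer (κ := κ) a b
  obtain ⟨c', s₁, t₁, h₁, h₂, h₃⟩ := exists_of_approximable hg hf
    (pushout.inl (coequalizer.π a b) c.w) (coequalizer.desc c.u hab)
    (pushout.desc (coequalizer.desc c.u hab ≫ f) c.v
      (by rw [← Category.assoc, coequalizer.π_desc, c.comm]))
    (by rw [pushout.inl_desc])
  refine ⟨c', homMk (coequalizer.π a b ≫ s₁) (pushout.inr _ _ ≫ t₁) ?_ ?_ ?_, ?_⟩
  · rw [Category.assoc, ← h₁, pushout.condition_assoc]
  · rw [Category.assoc, h₂, coequalizer.π_desc]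
  · rw [Category.assoc, h₃, pushout.inr_desc]
  · rw [map_homMk_left]
    exact coequalizer.condition_assoc a b s₁

lemma exists_coequalizing_right
    (hg : ∀ (K : M) [IsCardinalPresentable K κ], ∃ K', Nonempty (K ≅ g.obj K'))
    (hf : Approximable S κ f) (c : Approximation g S f) {K : M} [IsCardinalPresentable K κ]
    (a b : K ⟶ g.obj c.tgt) (hab : a ≫ c.v = b ≫ c.v) :
    ∃ (c' : Approximation g S f) (φ : c ⟶ c'), a ≫ g.map φ.right = b ≫ g.map φ.right := by
  have := isCardinalPresentable_coequalizer (κ := κ) a b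
  obtain ⟨c', s₁, t₁, h₁, h₂, h₃⟩ := exists_of_approximable hg hf
    (c.w ≫ coequalizer.π a b) c.u (coequalizer.desc c.v hab)
    (by rw [Category.assoc, coequalizer.π_desc, c.comm])
  refine ⟨c', homMk s₁ (coequalizer.π a b ≫ t₁) ?_ h₂ ?_, ?_⟩
  · rw [← h₁, Category.assoc]
  · rw [Category.assoc, h₃, coequalizer.π_desc]
  · rw [map_homMk_right]
    exact coequalizer.condition_assoc a b t₁

lemma final_toLeft [g.Faithful]
    (hg : ∀ (K : M) [IsCardinalPresentable K κ], ∃ K', Nonempty (K ≅ g.obj K'))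
    (hf : Approximable S κ f) :
    (toLeft : Approximation g S f ⥤ _).Final := by
  have := isCardinalFiltered hg hf
  have := isFiltered_of_isCardinalFiltered (Approximation g S f) κ
  refine Functor.final_of_exists_of_isFiltered _ (fun d => ?_) (fun {d c} s s' => ?_)
  · obtain ⟨c, s, t, h₁, h₂, h₃⟩ := exists_of_approximable hg hf (𝟙 (g.obj d.left)) d.hom
      (d.hom ≫ f) (by simp)
    exact ⟨c, ⟨CostructuredArrow.homMk (g.preimage s)
      ((congrArg (· ≫ c.u) (g.map_preimage s)).trans h₂)⟩⟩
  · obtain ⟨c', φ, hφ⟩ := exists_coequalizing_left hg hf c (g.map s.left) (g.map s'.left)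
      ((CostructuredArrow.w s).trans (CostructuredArrow.w s').symm)
    refine ⟨c', φ, CostructuredArrow.hom_ext _ _ (g.map_injective ?_)⟩
    exact (g.map_comp _ _).trans (hφ.trans (g.map_comp _ _).symm)

lemma final_toRight [g.Faithful]
    (hg : ∀ (K : M) [IsCardinalPresentable K κ], ∃ K', Nonempty (K ≅ g.obj K'))
    (hf : Approximable S κ f) :
    (toRight : Approximation g S f ⥤ _).Final := by
  have := isCardinalFiltered hg hf
  have := isFiltered_of_isCardinalFiltered (Approximation g S f) κ
  refine Functor.final_of_exists_of_isFiltered _ (fun d => ?_) (fun {d c} s s' => ?_)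
  · have := isCardinalPresentable_initial (M := M) κ
    obtain ⟨c, s, t, h₁, h₂, h₃⟩ := exists_of_approximable hg hf (initial.to (g.obj d.left))
      (initial.to X) d.hom (initial.hom_ext _ _)
    exact ⟨c, ⟨CostructuredArrow.homMk (g.preimage t)
      ((congrArg (· ≫ c.v) (g.map_preimage t)).trans h₃)⟩⟩
  · obtain ⟨c', φ, hφ⟩ := exists_coequalizing_right hg hf c (g.map s.left) (g.map s'.left)
      ((CostructuredArrow.w s).trans (CostructuredArrow.w s').symm)
    refine ⟨c', φ, CostructuredArrow.hom_ext _ _ (g.map_injective ?_)⟩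
    exact (g.map_comp _ _).trans (hφ.trans (g.map_comp _ _).symm)

/-- The canonical cocone exhibiting `X` as a colimit of the sources of approximations. -/
noncomputable def isColimitToX [g.Faithful] [g.IsDense]
    (hg : ∀ (K : M) [IsCardinalPresentable K κ], ∃ K', Nonempty (K ≅ g.obj K'))
    (hf : Approximable S κ f) :
    IsColimit (Cocone.mk X (toX : (_ : Approximation g S f ⥤ M) ⟶ _)) := by
  have := final_toLeft hg hf
  refine IsColimit.ofIsoColimit (F := toLeft ⋙ CostructuredArrow.proj g X ⋙ g)
    ((Functor.Final.isColimitWhiskerEquiv toLeft _).symm (g.denseAt X))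
    (Cocone.ext (Iso.refl _) (fun c => ?_))
  exact (Category.comp_id _).trans (Category.id_comp _)

/-- The canonical cocone exhibiting `Y` as a colimit of the targets of approximations. -/
noncomputable def isColimitToY [g.Faithful] [g.IsDense]
    (hg : ∀ (K : M) [IsCardinalPresentable K κ], ∃ K', Nonempty (K ≅ g.obj K'))
    (hf : Approximable S κ f) :
    IsColimit (Cocone.mk Y (toY : (_ : Approximation g S f ⥤ M) ⟶ _)) := by
  have := final_toRight hg hf
  refine IsColimit.ofIsoColimit (F := toRight ⋙ CostructuredArrow.proj g Y ⋙ g)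
    ((Functor.Final.isColimitWhiskerEquiv toRight _).symm (g.denseAt Y))
    (Cocone.ext (Iso.refl _) (fun c => ?_))
  exact (Category.comp_id _).trans (Category.id_comp _)

variable (g S f) in
/-- The canonical cocone with point `f` over the approximations of `f`. -/
@[simps]
def arrowCocone : Cocone (toArrow : Approximation g S f ⥤ _) where
  pt := Arrow.mk f
  ι :=
    { app c := Arrow.homMk c.u c.v c.comm
      naturality c c' φ := by
        refine Eq.trans ?_ (Category.comp_id _).symm
        exact Arrow.hom_ext _ _ φ.map_u φ.map_v }

end Approximation

/-- A cocone in the arrow category is a colimit if its source and target are. -/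
noncomputable def isColimitOfLeftRight {J : Type*} [Category* J] {F : J ⥤ Arrow M} (c : Cocone F)
    (hl : IsColimit (Arrow.leftFunc.mapCocone c)) (hr : IsColimit (Arrow.rightFunc.mapCocone c)) :
    IsColimit c where
  desc s := Arrow.homMk (hl.desc (Arrow.leftFunc.mapCocone s))
    (hr.desc (Arrow.rightFunc.mapCocone s)) (hl.hom_ext (fun j => by
      have h₁ := (c.ι.app j).w
      have h₂ := (s.ι.app j).w
      refine ((hl.fac_assoc (Arrow.leftFunc.mapCocone s) j s.pt.hom).trans h₂).trans (Eq.symm ?_)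
      refine ((Category.assoc _ _ _).symm.trans (congrArg (· ≫ _) h₁)).trans ?_
      refine (Category.assoc _ _ _).trans ?_
      exact congrArg ((F.obj j).hom ≫ ·) (hr.fac (Arrow.rightFunc.mapCocone s) j)))
  fac s j := Arrow.hom_ext _ _ (hl.fac (Arrow.leftFunc.mapCocone s) j)
    (hr.fac (Arrow.rightFunc.mapCocone s) j)
  uniq s m hm := Arrow.hom_ext _ _
    (hl.uniq (Arrow.leftFunc.mapCocone s) m.left (fun j => congrArg CommaMorphism.left (hm j)))
    (hr.uniq (Arrow.rightFunc.mapCocone s) m.right (fun j => congrArg CommaMorphism.right (hm j)))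

lemma Approximable.nonempty_filteredColimitPresentation {κ : Cardinal.{v}} [Fact κ.IsRegular]
    [IsCardinalLocallyPresentable M κ] {S : ModelStructure M} {X Y : M} {f : X ⟶ Y}
    (hf : Approximable S κ f) :
    Nonempty (FilteredColimitPresentation κ (PresentableArrowsIn κ {a : Arrow M | S.W a.hom})
      (Arrow.mk f)) := by
  let P := isCardinalPresentable M κ
  let e := equivSmallModel.{v} P.FullSubcategory
  let g : SmallModel.{v} P.FullSubcategory ⥤ M := e.inverse ⋙ P.ι
  have hK (K : SmallModel.{v} P.FullSubcategory) : IsCardinalPresentable (g.obj K) κ :=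
    (e.inverse.obj K).property
  have hg (K : M) [hK : IsCardinalPresentable K κ] : ∃ K', Nonempty (K ≅ g.obj K') :=
    ⟨e.functor.obj ⟨K, hK⟩, ⟨P.ι.mapIso (e.unitIso.app ⟨K, hK⟩)⟩⟩
  exact ⟨{
    J := Approximation g S f
    filtered := (isCardinalFiltered_iff_mathlib _ κ).2 (Approximation.isCardinalFiltered hg hf)
    F := Approximation.toArrow
    mem c := ⟨c.weq, (isPresentable_iff_mathlib _ _).2 (inferInstanceAs
      (IsCardinalPresentable (g.obj c.src) κ)), (isPresentable_iff_mathlib _ _).2 (inferInstanceAs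
      (IsCardinalPresentable (g.obj c.tgt) κ))⟩
    c := Approximation.arrowCocone g S f
    isColimit := isColimitOfLeftRight _ (Approximation.isColimitToX hg hf)
      (Approximation.isColimitToY hg hf)
    iso := Iso.refl _ }⟩

section Poset

open Cardinal

lemma exists_injective_of_small_subsets (κ : Cardinal.{v}) (X : Type v) :
    ∃ (Ω : Type v), Nonempty (({T : Set Ω // HasCardinalLT T κ} × X) ↪ Ω) := by
  let χ : Cardinal.{v} := max ℵ₀ (max κ (mk X))
  have hχ : ℵ₀ ≤ χ := le_max_left _ _
  have hκ : κ ≤ χ := (le_max_left _ _).trans (le_max_right _ _)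
  have hX : mk X ≤ χ := (le_max_right _ _).trans (le_max_right _ _)
  let Ω : Type v := ((2 : Cardinal.{v}) ^ χ).out
  have hΩ : mk Ω = 2 ^ χ := mk_out _
  have hΩ' : ℵ₀ ≤ mk Ω := hχ.trans (hΩ ▸ (cantor χ).le)
  refine ⟨Ω, ?_⟩
  change mk ({T : Set Ω // HasCardinalLT T κ} × X) ≤ mk Ω
  have h₁ : mk {T : Set Ω // HasCardinalLT T κ} ≤ mk Ω := by
    refine (mk_le_of_injective (f := fun T => (⟨T.1, ((hasCardinalLT_iff_cardinal_mk_lt _ _).1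
      T.2).le.trans hκ⟩ : {T : Set Ω // mk T ≤ χ}))
      (fun T T' h => Subtype.ext (congrArg (fun x => x.1) h))).trans ?_
    refine (mk_bounded_set_le Ω χ).trans ?_
    rw [max_eq_left hΩ', hΩ, ← power_mul, mul_eq_self hχ]
  rw [mk_prod, lift_id, lift_id]
  exact (mul_le_mul' h₁ (hX.trans (hΩ ▸ (cantor χ).le))).trans (mul_eq_self hΩ').le

lemma exists_directed_with_small_bounds (κ : Cardinal.{v}) [Fact κ.IsRegular] (J L : Type v)
    [PartialOrder J] [CategoryTheory.IsCardinalFiltered J κ] :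
    ∃ (P : Type v) (_ : PartialOrder P) (_ : CategoryTheory.IsCardinalFiltered P κ)
      (π : P ⥤ J) (_ : π.Final) (e : P × L → P),
      (∀ p l, p ≤ e (p, l)) ∧ ∀ p, HasCardinalLT {x // e x ≤ p} κ := by
  obtain ⟨Ω, ⟨ψ⟩⟩ := exists_injective_of_small_subsets κ (J × L)
  have hκ : ℵ₀ ≤ κ := Cardinal.IsRegular.aleph0_le Fact.out
  obtain ⟨P, _, ⟨φ⟩⟩ : ∃ (P : Type v) (_ : PartialOrder P),
      Nonempty (P ≃o ({T : Set Ω // HasCardinalLT T κ} × J)) :=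
    ⟨_, inferInstance, ⟨OrderIso.refl _⟩⟩
  have hP : CategoryTheory.IsCardinalFiltered P κ :=
    isCardinalFiltered_preorder _ _ (fun K s hK => by
      have hK' : HasCardinalLT.{v, v} K κ := (hasCardinalLT_iff_cardinal_mk_lt _ _).2 hK
      refine ⟨φ.symm (⟨⋃ k, (φ (s k)).1.1, hasCardinalLT_iUnion _ hK' (fun k => (φ (s k)).1.2)⟩,
        IsCardinalFiltered.max (fun k => (φ (s k)).2) hK'), fun k => ?_⟩
      rw [← φ.le_iff_le, φ.apply_symm_apply]
      exact ⟨Set.subset_iUnion (fun k => (φ (s k)).1.1) k,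
            leOfHom (IsCardinalFiltered.toMax (fun k => (φ (s k)).2) hK' k)⟩)
  have := isFiltered_of_isCardinalFiltered P κ
  have hsingle (ω : Ω) : HasCardinalLT ({ω} : Set Ω) κ := hasCardinalLT_of_finite _ _ hκ
  let π : P ⥤ J := Monotone.functor (f := fun p => (φ p).2) (fun _ _ h => (φ.monotone h).2)
  let e : P × L → P := fun x => φ.symm (⟨(φ x.1).1.1 ∪ {ψ ((φ x.1).1, ((φ x.1).2, x.2))},
    hasCardinalLT_union hκ (φ x.1).1.2 (hsingle _)⟩, (φ x.1).2)
  refine ⟨P, inferInstance, hP, π, ?_, e, fun p l => ?_, fun p => ?_⟩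
  · refine Functor.final_of_exists_of_isFiltered _ (fun j => ?_) (fun {j p} s s' => ?_)
    · refine ⟨φ.symm (⟨∅, hasCardinalLT_of_finite _ _ hκ⟩, j), ⟨homOfLE ?_⟩⟩
      change j ≤ (φ (φ.symm _)).2
      rw [φ.apply_symm_apply]
    · exact ⟨p, 𝟙 p, Subsingleton.elim _ _⟩
  · rw [← φ.le_iff_le, φ.apply_symm_apply]
    exact ⟨Set.subset_union_left, le_rfl⟩
  · have he (x : {x // e x ≤ p}) : ψ ((φ x.1.1).1, ((φ x.1.1).2, x.1.2)) ∈ (φ p).1.1 := by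
      have := x.2
      rw [← φ.le_iff_le, φ.apply_symm_apply] at this
      exact this.1 (Or.inr rfl)
    refine (φ p).1.2.of_injective (fun x => ⟨_, he x⟩) ?_
    rintro ⟨⟨q, l⟩, hx⟩ ⟨⟨q', l'⟩, hx'⟩ h
    have := ψ.injective (Subtype.ext_iff.1 h)
    simp only [Prod.mk.injEq] at this
    obtain rfl : q = q' := φ.injective (Prod.ext this.1 this.2.1)
    obtain rfl := this.2.2
    rfl

end Poset

lemma isCardinalPresentable_sigma (κ : Cardinal.{v}) [Fact κ.IsRegular] [HasColimits M]
    {I : Type v} (C : I → M) (hI : HasCardinalLT I κ) [∀ i, IsCardinalPresentable (C i) κ] :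
    IsCardinalPresentable (∐ C) κ := by
  have (i : Discrete I) : IsCardinalPresentable ((Discrete.functor C).obj i) κ :=
    inferInstanceAs (IsCardinalPresentable (C i.as) κ)
  exact isCardinalPresentable_of_isColimit _ (colimit.isColimit (Discrete.functor C)) κ
    ((hasCardinalLT_arrow_discrete_iff _).2 hI)

lemma isCardinalPresentable_sigma_free (κ : Cardinal.{v}) [Fact κ.IsRegular] [HasColimits M]
    {P I : Type v} [Preorder P] (pos : I → P) (C : I → M) [∀ i, IsCardinalPresentable (C i) κ]
    (q : P) (h : HasCardinalLT {i // pos i ≤ q} κ) :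
    IsCardinalPresentable (((evaluation P M).obj q).obj
      (∐ fun i => (evaluationLeftAdjoint M (pos i)).obj (C i))) κ := by
  have h' : HasCardinalLT (Σ i, (pos i ⟶ q)) κ :=
    h.of_injective (fun x => ⟨x.1, leOfHom x.2⟩) (by
      rintro ⟨i, s⟩ ⟨j, t⟩ h
      obtain rfl : i = j := congrArg Subtype.val h
      obtain rfl : s = t := Subsingleton.elim _ _
      rfl)
  have := isCardinalPresentable_sigma κ (fun x : (Σ i, (pos i ⟶ q)) => C x.1) h'
  exact isCardinalPresentable_of_iso
    ((PreservesCoproduct.iso ((evaluation P M).obj q) _ ≪≫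
      sigmaSigmaIso (fun i => (pos i ⟶ q)) (fun i _ => C i)).symm) κ

section Step

variable {S : ModelStructure M} {κ : Cardinal.{v}} [Fact κ.IsRegular] [HasColimits M]
  {ι : Type v} {A B : ι → M} (f : ∀ i, A i ⟶ B i)
  {P : Type v} [PartialOrder P]

/-- The lifting problems of the morphisms in the family `f` against the morphisms `d.app p`. -/
structure LiftingProblem {D : P ⥤ M} {Y : M} (d : D ⟶ (Functor.const P).obj Y) where
  /-- the position in the diagram -/
  p : P
  /-- the index of the morphism on the left of the problem -/
  i : ι
  /-- the top morphism -/
  a : A i ⟶ D.obj p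
  /-- the bottom morphism -/
  b : B i ⟶ Y
  w : a ≫ d.app p = f i ≫ b

lemma exists_step (hf : S.TrivCof = Llp (RlpOf f)) [∀ i, IsCardinalPresentable (A i) κ]
    [∀ i, IsCardinalPresentable (B i) κ] {Y : M} {L : Type v} (e : P × L → P)
    (he : ∀ p l, p ≤ e (p, l)) (he' : ∀ p, HasCardinalLT {x // e x ≤ p} κ)
    (hL : ∀ (K : M) [IsCardinalPresentable K κ],
      ∃ n : (Σ i, (A i ⟶ K) × (B i ⟶ Y)) → L, Function.Injective n)
    (D : P ⥤ M) (d : D ⟶ (Functor.const P).obj Y) (hD : ∀ p, IsCardinalPresentable (D.obj p) κ) :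
    ∃ (D' : P ⥤ M) (θ : D ⟶ D') (d' : D' ⟶ (Functor.const P).obj Y), θ ≫ d' = d ∧
      (∀ p, IsCardinalPresentable (D'.obj p) κ) ∧ (∀ p, S.TrivCof (θ.app p)) ∧
      ∀ (p : P) (i : ι) (a : A i ⟶ D.obj p) (b : B i ⟶ Y), a ≫ d.app p = f i ≫ b →
        ∃ (p' : P) (h : p ⟶ p') (l : B i ⟶ D'.obj p'),
          f i ≫ l = a ≫ D.map h ≫ θ.app p' ∧ l ≫ d'.app p' = b := by
  choose n hn using fun p => hL (D.obj p)
  let I := LiftingProblem f d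
  let pos (x : I) : P := e (x.p, n x.p ⟨x.i, x.a, x.b⟩)
  let toPos (x : I) : x.p ⟶ pos x := homOfLE (he _ _)
  have hpos (q : P) : HasCardinalLT {x // pos x ≤ q} κ :=
    (he' q).of_injective (fun x => ⟨_, x.2⟩) (by
      rintro ⟨⟨p, i, a, b, w⟩, hx⟩ ⟨⟨p', i', a', b', w'⟩, hx'⟩ h
      rw [Subtype.mk.injEq, Prod.mk.injEq] at h
      obtain ⟨h₁, h₂⟩ := h
      dsimp at h₁ h₂
      subst h₁
      have := hn _ h₂
      cases this
      rfl)
  let adj (x : I) := evaluationAdjunctionRight M (pos x)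
  let T : (∐ fun x : I => (evaluationLeftAdjoint M (pos x)).obj (A x.i)) ⟶
      (∐ fun x : I => (evaluationLeftAdjoint M (pos x)).obj (B x.i)) :=
    Limits.Sigma.map (fun x => (evaluationLeftAdjoint M (pos x)).map (f x.i))
  let top : (∐ fun x : I => (evaluationLeftAdjoint M (pos x)).obj (A x.i)) ⟶ D :=
    Limits.Sigma.desc (fun x => ((adj x).homEquiv _ _).symm (x.a ≫ D.map (toPos x)))
  let bot : (∐ fun x : I => (evaluationLeftAdjoint M (pos x)).obj (B x.i)) ⟶
      (Functor.const P).obj Y :=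
    Limits.Sigma.desc (fun x => ((adj x).homEquiv _ ((Functor.const P).obj Y)).symm x.b)
  have hd {p q : P} (t : p ⟶ q) : D.map t ≫ d.app q = d.app p :=
    (d.naturality t).trans (Category.comp_id _)
  have sq : top ≫ d = T ≫ bot := Limits.Sigma.hom_ext _ _ (fun x => by
    simp only [top, T, bot, Limits.Sigma.ι_desc_assoc, Limits.Sigma.ι_map_assoc,
      Limits.Sigma.ι_desc]
    rw [← Adjunction.homEquiv_naturality_right_symm, ← Adjunction.homEquiv_naturality_left_symm]
    congr 1
    exact (Category.assoc _ _ _).trans ((congrArg (x.a ≫ ·) (hd (toPos x))).trans x.w))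
  have hpush := IsPushout.of_hasPushout top T
  refine ⟨pushout top T, pushout.inl _ _, pushout.desc d bot sq, pushout.inl_desc _ _ _,
    fun p => ?_, ?_, fun p i a b w => ?_⟩
  · have := isCardinalPresentable_sigma_free κ pos (fun x : I => A x.i) p (hpos p)
    have := isCardinalPresentable_sigma_free κ pos (fun x : I => B x.i) p (hpos p)
    have : IsCardinalPresentable (((evaluation P M).obj p).obj D) κ := hD p
    exact isCardinalPresentable_of_isPushout κ (hpush.map ((evaluation P M).obj p))
  · refine trivCof_functorCategory_coproducts_pushouts f P hf _
      (MorphismProperty.pushouts_mk _ hpush (MorphismProperty.colimitsOfShape_le_coproducts _ I _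
        (MorphismProperty.colimitsOfShape_colimMap _ (fun x => ?_))))
    exact ⟨(x.as.i, pos x.as)⟩
  · let x : I := ⟨p, i, a, b, w⟩
    refine ⟨pos x, toPos x, (adj x).homEquiv _ _ (Limits.Sigma.ι (fun x : I =>
      (evaluationLeftAdjoint M (pos x)).obj (B x.i)) x ≫ pushout.inr top T), ?_, ?_⟩
    · refine ((adj x).homEquiv_naturality_left _ _).symm.trans ?_
      have h : (evaluationLeftAdjoint M (pos x)).map (f i) ≫ Limits.Sigma.ι (fun x : I =>
          (evaluationLeftAdjoint M (pos x)).obj (B x.i)) x ≫ pushout.inr top T =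
          ((adj x).homEquiv _ _).symm (x.a ≫ D.map (toPos x)) ≫ pushout.inl top T := by
        rw [← Limits.Sigma.ι_desc (fun x => ((adj x).homEquiv _ _).symm (x.a ≫ D.map (toPos x))) x,
          Category.assoc, pushout.condition, Limits.Sigma.ι_map_assoc]
      rw [h, Adjunction.homEquiv_naturality_right, Equiv.apply_symm_apply]
      exact Category.assoc _ _ _
    · refine ((adj x).homEquiv_naturality_right _ _).symm.trans ?_
      rw [Category.assoc, pushout.inr_desc, Limits.Sigma.ι_desc]
      exact Equiv.apply_symm_apply _ _

end Step

section Iteration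

variable {J : Type w} [LinearOrder J] [OrderBot J] [SuccOrder J] [WellFoundedLT J]

lemma exists_iteration [NoMaxOrder J] (C : Type*) [Category* C] [HasIterationOfShape J C]
    (O : ObjectProperty C) [O.IsClosedUnderIsomorphisms] (R : MorphismProperty C)
    (hR : ∀ ⦃X Y Z : C⦄ (t : X ⟶ Y) (e : Y ≅ Z), R t → R (t ≫ e.hom))
    (hstep : ∀ X, O X → ∃ (X' : C) (t : X ⟶ X'), O X' ∧ R t)
    (hO : ∀ (F : J ⥤ C) (j : J), Order.IsSuccLimit j →
      IsColimit ((Set.principalSegIio j).cocone F) → (∀ i < j, O (F.obj i)) → O (F.obj j))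
    (X₀ : C) (hX₀ : O X₀) :
    ∃ F : J ⥤ C, F.IsWellOrderContinuous ∧ Nonempty (F.obj ⊥ ≅ X₀) ∧ (∀ j, O (F.obj j)) ∧
      ∀ j, R (F.map (homOfLE (Order.le_succ j))) := by
  classical
  choose s t hs ht using hstep
  let Φ : SmallObject.SuccStruct C :=
    { X₀ := X₀
      succ X := if h : O X then s X h else X
      toSucc X := if h : O X then t X h ≫ eqToHom (dif_pos h).symm
        else eqToHom (by rw [dif_neg h]) }
  have hΦ (X : C) (hX : O X) : O (Φ.succ X) := by
    simp only [Φ, dif_pos hX, hs]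
  have hΦ' (X : C) (hX : O X) : R (Φ.toSucc X) := by
    simp only [Φ, dif_pos hX]
    exact hR (t X hX) (eqToIso (dif_pos hX).symm) (ht X hX)
  have hmem (j : J) : O ((Φ.iterationFunctor J).obj j) := by
    induction j using SuccOrder.limitRecOn with
    | isMin j hj =>
      obtain rfl := hj.eq_bot
      exact O.prop_of_iso (Φ.iterationFunctorObjBotIso J).symm hX₀
    | succ j hj hj' =>
      exact O.prop_of_iso (Φ.iterationFunctorObjSuccIso j hj).symm (hΦ _ hj')
    | isSuccLimit j hj hj' =>
      exact hO _ j hj (Functor.isColimitOfIsWellOrderContinuous _ j hj) hj'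
  refine ⟨Φ.iterationFunctor J, inferInstance, ⟨Φ.iterationFunctorObjBotIso J⟩, hmem, fun j => ?_⟩
  rw [Φ.iterationFunctor_map_succ j (not_isMax j)]
  exact hR _ (Φ.iterationFunctorObjSuccIso j (not_isMax j)).symm (hΦ' _ (hmem j))

lemma mem_map_of_isWellOrderContinuous {C : Type*} [Category* C] [HasColimitsOfShape J C]
    (W : MorphismProperty C) [MorphismProperty.IsStableUnderTransfiniteComposition.{w} W]
    (F : J ⥤ C) [F.IsWellOrderContinuous]
    (h : ∀ j, W (F.map (homOfLE (Order.le_succ j)))) {i j : J} (φ : i ⟶ j) : W (F.map φ) := by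
  let T : W.TransfiniteCompositionOfShape J (colimit.ι F ⊥) :=
    { F := F
      isoBot := Iso.refl _
      incl := (colimit.cocone F).ι
      isColimit := colimit.isColimit F
      fac := by simp
      map_mem j _ := h j }
  exact T.mem_map φ

end Iteration

section Tower

variable {S : ModelStructure M} {κ : Cardinal.{v}} [Fact κ.IsRegular]
  {J P : Type v} [SmallCategory J] [SmallCategory P]
  [CategoryTheory.IsCardinalFiltered J κ] [CategoryTheory.IsCardinalFiltered P κ]
  (G : J ⥤ P ⥤ M)

lemma weq_and_approximable_of_tower [HasColimits M] (h : IsCombinatorial S κ)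
    (hG : ∀ j p, IsCardinalPresentable ((G.obj j).obj p) κ) {j₀ : J} (hj₀ : IsInitial j₀)
    (hW : ∀ j p, S.W ((G.map (hj₀.to j)).app p)) {c : Cocone (G.obj j₀)} (hc : IsColimit c)
    {d : Cocone (Functor.uncurry.obj G)} (hd : IsColimit d) (g : c.pt ⟶ d.pt)
    (hg : ∀ p, c.ι.app p ≫ g = d.ι.app (j₀, p)) :
    S.W g ∧ Approximable S κ g := by
  have := isFiltered_of_isCardinalFiltered J κ
  have := isFiltered_of_isCardinalFiltered P κ
  let φ : CategoryTheory.Prod.snd J P ⋙ G.obj j₀ ⟶ Functor.uncurry.obj G :=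
    { app x := (G.map (hj₀.to x.1)).app x.2
      naturality x y t := by
        have e : hj₀.to x.1 ≫ t.1 = hj₀.to y.1 := hj₀.hom_ext _ _
        have e' : (G.map (hj₀.to x.1)).app x.2 ≫ (G.map t.1).app x.2 =
            (G.map (hj₀.to y.1)).app x.2 := by
          rw [← NatTrans.comp_app, ← G.map_comp, e]
        calc (G.obj j₀).map t.2 ≫ (G.map (hj₀.to y.1)).app y.2
            = (G.map (hj₀.to y.1)).app x.2 ≫ (G.obj y.1).map t.2 := NatTrans.naturality _ _
          _ = (G.map (hj₀.to x.1)).app x.2 ≫ (G.map t.1).app x.2 ≫ (G.obj y.1).map t.2 := by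
            rw [← e', Category.assoc] }
  have hc' : IsColimit (c.whisker (CategoryTheory.Prod.snd J P)) :=
    (Functor.Final.isColimitWhiskerEquiv (CategoryTheory.Prod.snd J P) c).symm hc
  have hg' (x : J × P) : (c.whisker (CategoryTheory.Prod.snd J P)).ι.app x ≫ g =
      φ.app x ≫ d.ι.app x := by
    have e := d.w (show (j₀, x.2) ⟶ x from (hj₀.to x.1, 𝟙 x.2))
    have e' : (Functor.uncurry.obj G).map (show (j₀, x.2) ⟶ x from (hj₀.to x.1, 𝟙 x.2)) =
        (G.map (hj₀.to x.1)).app x.2 :=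
      (congrArg (_ ≫ ·) ((G.obj x.1).map_id x.2)).trans (Category.comp_id _)
    rw [e'] at e
    exact (hg x.2).trans e.symm
  have hφ (x : J × P) : S.W (φ.app x) := hW x.1 x.2
  have (x : J × P) : IsCardinalPresentable ((CategoryTheory.Prod.snd J P ⋙ G.obj j₀).obj x) κ :=
    hG j₀ x.2
  have (x : J × P) : IsCardinalPresentable ((Functor.uncurry.obj G).obj x) κ := hG x.1 x.2
  have : CategoryTheory.IsCardinalFiltered (J × P) κ := isCardinalFiltered_prod _ _ _
  exact ⟨weq_of_isColimit κ h hc' hd φ g hg' hφ, .of_isColimit hc' hd φ g hg' hφ⟩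

/-- A tower of diagrams over `Y` which solves all the lifting problems against a set of generating
trivial cofibrations exhibits a weak equivalence as a composition of an approximable weak
equivalence and of a trivial fibration. -/
lemma approximable_of_tower [HasColimits M] (h : IsCombinatorial S κ)
    (hS : HasPresentableFactorizations S κ)
    {ι : Type v} {A B : ι → M} (f : ∀ i, A i ⟶ B i) (hf : S.TrivCof = Llp (RlpOf f))
    [∀ i, IsCardinalPresentable (A i) κ]
    (hG : ∀ j p, IsCardinalPresentable ((G.obj j).obj p) κ) {Y : M}
    (γ : ∀ j, G.obj j ⟶ (Functor.const P).obj Y)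
    (hγ : ∀ ⦃j j' : J⦄ (t : j ⟶ j'), G.map t ≫ γ j' = γ j)
    (hlift : ∀ (j : J) (p : P) (i : ι) (a : A i ⟶ (G.obj j).obj p) (b : B i ⟶ Y),
      a ≫ (γ j).app p = f i ≫ b → ∃ (j' : J) (p' : P) (s : j ⟶ j') (t : p ⟶ p')
        (l : B i ⟶ (G.obj j').obj p'), f i ≫ l = a ≫ (G.obj j).map t ≫ (G.map s).app p' ∧
          l ≫ (γ j').app p' = b)
    {j₀ : J} (hj₀ : IsInitial j₀)
    (hW : ∀ j p, S.W ((G.map (hj₀.to j)).app p)) {c : Cocone (G.obj j₀)} (hc : IsColimit c)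
    (g : c.pt ⟶ Y) (hg : ∀ p, c.ι.app p ≫ g = (γ j₀).app p) (hg' : S.W g) :
    Approximable S κ g := by
  let D := Functor.uncurry.obj G
  let d : Cocone D := colimit.cocone D
  have hd : IsColimit d := colimit.isColimit D
  have D_map {x y : J × P} (t : x ⟶ y) :
      D.map t = (G.obj x.1).map t.2 ≫ (G.map t.1).app y.2 :=
    ((G.map t.1).naturality t.2).symm
  let e : Cocone D :=
    { pt := Y
      ι :=
        { app x := (γ x.1).app x.2
          naturality x y t := by
            have h₁ := NatTrans.congr_app (hγ t.1) y.2
            have h₂ := (γ x.1).naturality t.2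
            dsimp at h₁ h₂ ⊢
            rw [D_map, Category.assoc, h₁, h₂] } }
  let k : c.pt ⟶ d.pt := hc.desc
    { pt := d.pt
      ι :=
        { app p := d.ι.app (j₀, p)
          naturality p p' t := by
            have h₁ := d.w (show (j₀, p) ⟶ (j₀, p') from (𝟙 j₀, t))
            have h₂ : D.map (show (j₀, p) ⟶ (j₀, p') from (𝟙 j₀, t)) = (G.obj j₀).map t := by
              rw [D_map]
              dsimp
              rw [G.map_id]
              exact Category.comp_id _
            rw [h₂] at h₁
            exact h₁.trans (Category.comp_id _).symm } }
  have hk (p : P) : c.ι.app p ≫ k = d.ι.app (j₀, p) := hc.fac _ p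
  obtain ⟨hk₁, hk₂⟩ := weq_and_approximable_of_tower G h hG hj₀ hW hc hd k hk
  let q : d.pt ⟶ Y := hd.desc e
  have hq (x : J × P) : d.ι.app x ≫ q = (γ x.1).app x.2 := hd.fac e x
  have fac : k ≫ q = g := hc.hom_ext fun p => by
    rw [← Category.assoc, hk, hq, hg]
  have hqF : S.Fib q := by
    rw [← S.rlpOf_eq_of_trivCof_eq hf]
    intro i
    have : CategoryTheory.IsCardinalFiltered (J × P) κ := isCardinalFiltered_prod _ _ _
    constructor
    intro u b sq
    obtain ⟨x, a, ha⟩ := IsCardinalPresentable.exists_hom_of_isColimit κ hd u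
    obtain ⟨j', p', s, t, l, h₁, h₂⟩ := hlift x.1 x.2 i a b (by
      rw [← hq, ← sq.w, ← ha, Category.assoc])
    refine ⟨⟨⟨l ≫ d.ι.app (j', p'), ?_, ?_⟩⟩⟩
    · have h₃ := d.w (show x ⟶ (j', p') from (s, t))
      rw [D_map] at h₃
      rw [← Category.assoc, h₁, ← ha, ← h₃]
      exact Category.assoc _ _ _
    · rw [Category.assoc, hq, h₂]
  rw [← fac] at hg' ⊢
  exact Approximable.comp hS hk₂ (hS.approximable_of_trivFib ⟨hqF, S.W_of_comp_left _ _ hk₁ hg'⟩)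

end Tower

lemma hasCardinalLT_arrow_of_preorder {κ : Cardinal.{v}} [Fact κ.IsRegular] {K : Type v}
    [Preorder K] (hK : HasCardinalLT K κ) : HasCardinalLT (Arrow K) κ := by
  have h : HasCardinalLT (K × K) κ := by
    rw [hasCardinalLT_iff_cardinal_mk_lt] at hK ⊢
    simpa using Cardinal.mul_lt_of_lt (Cardinal.IsRegular.aleph0_le Fact.out) hK hK
  refine h.of_injective (fun a => (a.left, a.right)) ?_
  rintro ⟨x, y, s⟩ ⟨x', y', t⟩ h
  obtain ⟨rfl, rfl⟩ : x = x' ∧ y = y' := by simpa using h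
  obtain rfl : s = t := Subsingleton.elim _ _
  rfl

section

variable {S : ModelStructure M} {κ : Cardinal.{v}} [Fact κ.IsRegular] [HasColimits M]
  {ι : Type v} {A B : ι → M} (f : ∀ i, A i ⟶ B i)
  {P : Type v} [PartialOrder P]
  {J : Type v} [LinearOrder J] [OrderBot J] [SuccOrder J] [WellFoundedLT J] [NoMaxOrder J]

/-- The transfinite iteration of `exists_step`. -/
lemma exists_tower (hJ : ∀ j : J, HasCardinalLT (Set.Iio j) κ)
    (hf : S.TrivCof = Llp (RlpOf f)) [∀ i, IsCardinalPresentable (A i) κ]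
    [∀ i, IsCardinalPresentable (B i) κ] {Y : M} {L : Type v} (e : P × L → P)
    (he : ∀ p l, p ≤ e (p, l)) (he' : ∀ p, HasCardinalLT {x // e x ≤ p} κ)
    (hL : ∀ (K : M) [IsCardinalPresentable K κ],
      ∃ n : (Σ i, (A i ⟶ K) × (B i ⟶ Y)) → L, Function.Injective n)
    (D : P ⥤ M) (d : D ⟶ (Functor.const P).obj Y) (hD : ∀ p, IsCardinalPresentable (D.obj p) κ) :
    ∃ F : J ⥤ Over ((Functor.const P).obj Y), Nonempty (F.obj ⊥ ≅ Over.mk d) ∧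
      (∀ j p, IsCardinalPresentable ((F.obj j).left.obj p) κ) ∧
      (∀ j p, S.TrivCof ((F.map (homOfLE bot_le : ⊥ ⟶ j)).left.app p)) ∧
      ∀ (j : J) (p : P) (i : ι) (a : A i ⟶ (F.obj j).left.obj p) (b : B i ⟶ Y),
        a ≫ (F.obj j).hom.app p = f i ≫ b →
        ∃ (j' : J) (p' : P) (s : j ⟶ j') (t : p ⟶ p') (l : B i ⟶ (F.obj j').left.obj p'),
          f i ≫ l = a ≫ (F.obj j).left.map t ≫ (F.map s).left.app p' ∧
            l ≫ (F.obj j').hom.app p' = b := by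
  let C := Over ((Functor.const P).obj Y)
  let ev (p : P) : C ⥤ M := Over.forget _ ⋙ (evaluation P M).obj p
  let O : ObjectProperty C := fun X => ∀ p, IsCardinalPresentable (X.left.obj p) κ
  have : O.IsClosedUnderIsomorphisms :=
    ⟨fun {X _} t h p =>
      have : IsCardinalPresentable ((ev p).obj X) κ := h p
      isCardinalPresentable_of_iso ((ev p).mapIso t) κ⟩
  let R : MorphismProperty C := fun X X' t => (∀ p, S.TrivCof (t.left.app p)) ∧
    ∀ (p : P) (i : ι) (a : A i ⟶ X.left.obj p) (b : B i ⟶ Y), a ≫ X.hom.app p = f i ≫ b →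
      ∃ (p' : P) (h : p ⟶ p') (l : B i ⟶ X'.left.obj p'),
        f i ≫ l = a ≫ X.left.map h ≫ t.left.app p' ∧ l ≫ X'.hom.app p' = b
  have hR ⦃X X' Z : C⦄ (t : X ⟶ X') (e : X' ≅ Z) (ht : R t) : R (t ≫ e.hom) := by
    refine ⟨fun p => ?_, fun p i a b h => ?_⟩
    · have : IsIso (e.hom.left.app p) := ((ev p).mapIso e).isIso_hom
      exact (MorphismProperty.cancel_right_of_respectsIso S.TrivCof _ _).2 (ht.1 p)
    · obtain ⟨p', h, l, h₁, h₂⟩ := ht.2 p i a b h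
      refine ⟨p', h, l ≫ e.hom.left.app p', ?_, ?_⟩
      · rw [← Category.assoc, h₁, Category.assoc, Category.assoc]
        rfl
      · have h₃ := NatTrans.congr_app (Over.w e.hom) p'
        rw [NatTrans.comp_app] at h₃
        rw [Category.assoc, h₃, h₂]
  obtain ⟨F, _, hF₀, hF₁, hF₂⟩ := exists_iteration (J := J) C O R hR (fun X hX => by
      obtain ⟨D', θ, d', h₁, h₂, h₃, h₄⟩ := exists_step f hf e he he' hL X.left X.hom hX
      exact ⟨Over.mk d', Over.homMk θ h₁, h₂, h₃, h₄⟩)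
    (fun F j hj hF h p => by
      have : ∀ i : Set.Iio j, IsCardinalPresentable
          ((((Set.principalSegIio j).monotone.functor ⋙ F) ⋙ ev p).obj i) κ := fun i => h _ i.2 p
      exact isCardinalPresentable_of_isColimit _ (isColimitOfPreserves (ev p) hF) κ
        (hasCardinalLT_arrow_of_preorder (hJ j)))
    (Over.mk d) hD
  refine ⟨F, hF₀, hF₁, fun j p => ?_, fun j p i a b w => ?_⟩
  · have : MorphismProperty.IsStableUnderTransfiniteComposition.{v} S.TrivCof := by
      rw [S.trivCof_eq_llp]
      infer_instance
    have : (F ⋙ ev p).IsWellOrderContinuous :=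
      ⟨fun j hj => ⟨isColimitOfPreserves (ev p) (F.isColimitOfIsWellOrderContinuous j hj)⟩⟩
    have h := mem_map_of_isWellOrderContinuous S.TrivCof (F ⋙ ev p) (fun j => (hF₂ j).1 p)
      (homOfLE bot_le : ⊥ ⟶ j)
    exact h
  · obtain ⟨p', t, l, h₁, h₂⟩ := (hF₂ j).2 p i a b w
    exact ⟨_, p', _, t, l, h₁, h₂⟩

end

/-- In a combinatorial model category with presentable factorizations, every weak equivalence is
approximable. -/
theorem approximable_of_weq {S : ModelStructure M} {κ : Cardinal.{v}} [Fact κ.IsRegular]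
    [IsCardinalLocallyPresentable M κ] (h : IsCombinatorial S κ)
    (hS : HasPresentableFactorizations S κ) {X Y : M} (g : X ⟶ Y) (hg : S.W g) :
    Approximable S κ g := by
  obtain ⟨ι, A, B, f, hA, hB, hf⟩ := h.trivCofGenerated
  simp only [isPresentable_iff_mathlib] at hA hB
  have hκ : Cardinal.aleph0 ≤ κ := Cardinal.IsRegular.aleph0_le Fact.out
  -- the labels of the lifting problems
  let E := equivSmallModel.{v} (isCardinalPresentable M κ).FullSubcategory
  let G := E.inverse ⋙ (isCardinalPresentable M κ).ι
  let L : Type v := Σ K, Σ i, (A i ⟶ G.obj K) × (B i ⟶ Y)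
  have hL (K : M) [hK : IsCardinalPresentable K κ] :
      ∃ n : (Σ i, (A i ⟶ K) × (B i ⟶ Y)) → L, Function.Injective n := by
    let K' : (isCardinalPresentable M κ).FullSubcategory := ⟨K, hK⟩
    let t : K ≅ G.obj (E.functor.obj K') :=
      (isCardinalPresentable M κ).ι.mapIso (E.unitIso.app K')
    refine ⟨fun x => ⟨E.functor.obj K', x.1, x.2.1 ≫ t.hom, x.2.2⟩, ?_⟩
    rintro ⟨i, a, b⟩ ⟨i', a', b'⟩ hx
    obtain ⟨rfl, hx⟩ := Sigma.mk.inj_iff.1 (eq_of_heq (Sigma.mk.inj_iff.1 hx).2)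
    obtain ⟨h₁, h₂⟩ := Prod.ext_iff.1 (eq_of_heq hx)
    dsimp at h₁ h₂
    rw [(cancel_mono _).1 h₁, h₂]
  -- the source as a directed colimit of presentable objects
  obtain ⟨_, γ, G', hG', hX⟩ := h.locallyPresentable
  obtain ⟨pres⟩ := hX X
  let := pres.instJ
  have := (isCardinalFiltered_iff_mathlib pres.J κ).1 pres.filtered
  have hpres (j : pres.J) : IsCardinalPresentable (pres.F.obj j) κ := by
    obtain ⟨i, hi⟩ := pres.mem j
    rw [← hi]
    exact (isPresentable_iff_mathlib κ _).1 (hG' i)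
  obtain ⟨α, _, _, T, _⟩ := IsCardinalFiltered.exists_cardinal_directed pres.J κ
  obtain ⟨P, _, _, π, _, e, he, he'⟩ := exists_directed_with_small_bounds κ α L
  let D : P ⥤ M := (π ⋙ T) ⋙ pres.F
  let c : Cocone D := pres.c.whisker (π ⋙ T)
  have hc : IsColimit c := (Functor.Final.isColimitWhiskerEquiv (π ⋙ T) pres.c).symm pres.isColimit
  let d : D ⟶ (Functor.const P).obj Y :=
    c.ι ≫ (Functor.const P).map (pres.iso.hom ≫ g)
  -- the tower
  have : Nonempty κ.ord.ToType := by simpa using Cardinal.IsRegular.ne_zero Fact.out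
  let := WellFoundedLT.toOrderBot κ.ord.ToType
  let := SuccOrder.ofLinearWellFoundedLT κ.ord.ToType
  have := Cardinal.noMaxOrder hκ
  obtain ⟨F, ⟨i₀⟩, hF₁, hF₂, hF₃⟩ := exists_tower (J := κ.ord.ToType) f
    (fun j => by
      rw [hasCardinalLT_iff_cardinal_mk_lt]
      simpa using Cardinal.mk_Iio_lt j (by simp)) hf e he he' hL D d (fun p => hpres _)
  let i₁ : (F.obj ⊥).left ≅ D := (Over.forget _).mapIso i₀
  have hi₁ : i₁.hom ≫ d = (F.obj ⊥).hom := Over.w i₀.hom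
  let c' : Cocone (F.obj ⊥).left := (Cocone.precompose i₁.hom).obj c
  have hc' : IsColimit c' := (IsColimit.precomposeHomEquiv i₁ c).symm hc
  have key : Approximable S κ (pres.iso.hom ≫ g) :=
    approximable_of_tower (F ⋙ Over.forget _) h hS f hf hF₁ (fun j => (F.obj j).hom)
      (fun _ _ t => Over.w (F.map t)) hF₃ (j₀ := ⊥) (IsInitial.ofUnique ⊥)
      (fun j p => (hF₂ j p).2) hc' (pres.iso.hom ≫ g)
      (fun p => by
        rw [← hi₁]
        exact Category.assoc _ _ _)
      (S.W.comp_mem _ _ (MorphismProperty.of_isIso _ _) hg)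
  intro K K' _ _ a u v w
  obtain ⟨N, N', h₁, h₂, b, s, t, u', v', hb, e₁, e₂, e₃, e₄⟩ :=
    key a (u ≫ pres.iso.inv) v (by simpa using w)
  exact ⟨N, N', h₁, h₂, b, s, t, u' ≫ pres.iso.hom, v', hb, e₁, by simpa using e₂,
    by rw [← Category.assoc, e₃, Category.assoc, Iso.inv_hom_id, Category.comp_id], e₄⟩

end PaperAcc

namespace PaperAcc

/-- Corollary 5.7. Let `M` be a left proper `κ`-combinatorial model
category satisfying conditions (i) and (iii) of the main theorem, and let `Smor` be a set of
morphisms of `M`. Suppose the left Bousfield localization `L_S M` of `M` at `Smor` (the model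
structure with the same cofibrations whose weak equivalences form the smallest class of weak
equivalences of a model structure with these cofibrations containing the weak equivalences of
`M` and `Smor`, namely the `S`-local equivalences) is `λ`-combinatorial for some regular
`λ ≥ κ` and that every object of a generating set as in (i) for `L_S M` has a `λ`-presentable
cylinder object in `L_S M`. Then the full subcategory `W_S` of `(L_S M)^→` spanned by the
`S`-local equivalences is `λ`-accessible: it is closed under `λ`-filtered colimits and every
`S`-local equivalence is a `λ`-filtered colimit of `S`-local equivalences between
`λ`-presentable objects. -/
theorem statement12 {M : Type u} [Category.{v} M] (κ lam : Cardinal.{v}) (hκlam : κ ≤ lam)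
    (S : ModelStructure M) (hcomb : IsCombinatorial S κ)
    -- `M` is left proper
    (hproper : ∀ {A B X P : M} (i : A ⟶ B) (f : A ⟶ X) (g : B ⟶ P) (h : X ⟶ P),
      S.Cof i → S.W f → IsPushout i f g h → S.W g)
    -- (i) for `M`
    (A : Set M)
    (hA₁ : ∀ X ∈ A, IsPresentable κ X ∧ Cofibrant S X)
    (hA₂ : ∀ X : M, Nonempty (FilteredColimitPresentation κ A X))
    -- (iii) for `M`
    (hformal : ∀ {P Q R : M} (i : P ⟶ Q) (q : Q ⟶ R), S.Cof (i ≫ q) →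
      Cofibrant S P → Cofibrant S R → IsFormalCofibration S i)
    -- the left Bousfield localization of `S` at `Smor`
    (Smor : Set (Arrow M)) (LS : ModelStructure M)
    (hL₁ : LS.Cof = S.Cof) (hL₂ : S.W ≤ LS.W) (hL₃ : ∀ a ∈ Smor, LS.W a.hom)
    (hLmin : ∀ N : ModelStructure M, N.Cof = S.Cof → S.W ≤ N.W →
      (∀ a ∈ Smor, N.W a.hom) → LS.W ≤ N.W)
    -- `L_S M` is `λ`-combinatorial
    (hLcomb : IsCombinatorial LS lam)
    -- (i) and (ii) for `L_S M` at `λ`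
    (B : Set M)
    (hB₁ : ∀ X ∈ B, IsPresentable lam X ∧ Cofibrant LS X)
    (hB₂ : ∀ X : M, Nonempty (FilteredColimitPresentation lam B X))
    (hBcyl : ∀ X ∈ B, ∃ cyl : CylinderObject LS X, IsPresentable lam cyl.C) :
    ClosedUnderFilteredColimits lam {a : Arrow M | LS.W a.hom} ∧
    ∀ {X Y : M} (f : X ⟶ Y), LS.W f →
      Nonempty (FilteredColimitPresentation (M := Arrow M) lam
        (PresentableArrowsIn lam {a : Arrow M | LS.W a.hom}) (Arrow.mk f)) := by
  have : Fact lam.IsRegular := ⟨hLcomb.isRegular⟩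
  have := isCardinalLocallyPresentable_of_paper lam hLcomb.locallyPresentable
  refine ⟨fun J _ hJ F c hc hF => ?_, fun f hf => ?_⟩
  · have := (isCardinalFiltered_iff_mathlib J lam).1 hJ
    exact weq_of_isColimit lam hLcomb (isColimitOfPreserves Arrow.leftFunc hc)
      (isColimitOfPreserves Arrow.rightFunc hc) (Functor.whiskerLeft F Arrow.leftToRight) c.pt.hom
      (fun j => Arrow.w (c.ι.app j)) hF
  · exact (approximable_of_weq hLcomb (hasPresentableFactorizations S LS lam hformal hL₁ hL₂ B hB₁
      hB₂ hBcyl) f hf).nonempty_filteredColimitPresentation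

end PaperAcc
end

section
/- Let C be a cocomplete category, κ a regular cardinal, and I a set of morphisms of C whose domains and codomains are all κ-presentable objects. Then the class I^□ of morphisms having the right lifting property with respect to every morphism of I is closed under κ-filtered colimits in the arrow category C^→. -/
open CategoryTheory CategoryTheory.Limits

universe w v u

namespace PaperAcc

/-- A `κ`-filtered category in the above sense is filtered, for `κ` infinite. -/
lemma IsCardinalFiltered.isFiltered_s13 {J : Type v} [SmallCategory J] {κ : Cardinal.{v}}
    (hJ : IsCardinalFiltered J κ) (hκ : Cardinal.aleph0 ≤ κ) : IsFiltered J := by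
  refine IsFiltered.of_cocone_nonempty.{v} J fun {K} _ _ F => hJ K ?_ F
  have : Finite (Arrow K) := Finite.of_equiv (Σ p : K × K, p.1 ⟶ p.2)
    { toFun := fun p => Arrow.mk p.2
      invFun := fun a => ⟨(a.left, a.right), a.hom⟩
      left_inv := fun _ => rfl
      right_inv := fun _ => rfl }
  exact (Cardinal.lt_aleph0_of_finite _).trans_le hκ

/-- If `Hom(A, -)` and `Hom(B, -)` preserve colimits of a filtered shape `J`, then the right
lifting property with respect to a morphism `A ⟶ B` is inherited by colimits of shape `J` in the
arrow category. -/
lemma hasLiftingProperty_of_isColimit_arrow {C : Type u} [Category.{v} C] {J : Type v}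
    [SmallCategory J] [IsFiltered J] [HasColimitsOfShape J C] {A B : C} (f : A ⟶ B)
    [PreservesColimitsOfShape J (coyoneda.obj (Opposite.op A))]
    [PreservesColimitsOfShape J (coyoneda.obj (Opposite.op B))]
    {F : J ⥤ Arrow C} {c : Cocone F} (hc : IsColimit c)
    (hF : ∀ j, HasLiftingProperty f (F.obj j).hom) : HasLiftingProperty f c.pt.hom := by
  have hl := isColimitOfPreserves Arrow.leftFunc hc
  have hr := isColimitOfPreserves Arrow.rightFunc hc
  refine ⟨fun {a b} sq => ?_⟩
  obtain ⟨j₁, p, hp⟩ : ∃ (j : J) (p : A ⟶ (F.obj j).left), p ≫ (c.ι.app j).left = a :=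
    exists_hom_of_preservesColimit_coyoneda hl a
  obtain ⟨j₂, q, hq⟩ : ∃ (j : J) (q : B ⟶ (F.obj j).right), q ≫ (c.ι.app j).right = b :=
    exists_hom_of_preservesColimit_coyoneda hr b
  have hw (j : J) : (c.ι.app j).left ≫ c.pt.hom = (F.obj j).hom ≫ (c.ι.app j).right :=
    Arrow.w (c.ι.app j)
  have heq : (p ≫ (F.obj j₁).hom) ≫ (c.ι.app j₁).right = (f ≫ q) ≫ (c.ι.app j₂).right := by
    rw [Category.assoc, Category.assoc, hq, ← sq.w, ← hp, Category.assoc, hw j₁]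
  obtain ⟨k, s, t, hst⟩ : ∃ (k : J) (s : j₁ ⟶ k) (t : j₂ ⟶ k),
      (p ≫ (F.obj j₁).hom) ≫ (F.map s).right = (f ≫ q) ≫ (F.map t).right :=
    exists_eq_of_preservesColimit_coyoneda hr (p ≫ (F.obj j₁).hom) (f ≫ q) heq
  have hsq : CommSq (p ≫ (F.map s).left) f (F.obj k).hom (q ≫ (F.map t).right) :=
    ⟨by rw [Category.assoc, Arrow.w, ← Category.assoc, hst, Category.assoc]⟩
  have := hF k
  have hs : (F.map s).left ≫ (c.ι.app k).left = (c.ι.app j₁).left :=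
    congrArg CommaMorphism.left (c.w s)
  have ht : (F.map t).right ≫ (c.ι.app k).right = (c.ι.app j₂).right :=
    congrArg CommaMorphism.right (c.w t)
  refine ⟨⟨⟨hsq.lift ≫ (c.ι.app k).left, ?_, ?_⟩⟩⟩
  · rw [← Category.assoc, hsq.fac_left, Category.assoc, hs, hp]
  · rw [Category.assoc, hw k, ← Category.assoc, hsq.fac_right, Category.assoc, ht, hq]

/-- Let `C` be a cocomplete category, `κ` a regular cardinal, and `I` a set
of morphisms of `C` whose domains and codomains are `κ`-presentable. Then the class `I^□` of
morphisms having the right lifting property with respect to every morphism of `I` is closed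
under `κ`-filtered colimits in the arrow category `C^→`. -/
theorem statement13 {C : Type u} [Category.{v} C] [HasColimits C]
    (κ : Cardinal.{v}) (hκ : κ.IsRegular)
    (ι : Type w) (A B : ι → C) (f : ∀ i, A i ⟶ B i)
    (hA : ∀ i, IsPresentable κ (A i)) (hB : ∀ i, IsPresentable κ (B i)) :
    ClosedUnderFilteredColimits κ {a : Arrow C | RlpOf f a.hom} := by
  intro J _ hJ F c hc hF i
  have := hJ.isFiltered_s13 hκ.aleph0_le
  obtain ⟨_⟩ := hA i J hJ
  obtain ⟨_⟩ := hB i J hJ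
  exact hasLiftingProperty_of_isColimit_arrow (f i) hc fun j => hF j i

end PaperAcc
end

section
/- Let M be a κ-combinatorial model category and let λ ≥ κ be a regular cardinal such that the replacement-by-fibration functor R_fib: M^→ → M^→ (arising from the (trivial cofibration, fibration)-factorization given by the small object argument) preserves λ-filtered colimits and λ-presentable objects. Then every fibration in M is a λ-filtered colimit in M^→ of fibrations between λ-presentable objects. -/
open CategoryTheory CategoryTheory.Limits

universe w v u

namespace CategoryTheory

section Factorization

variable {C : Type u} [Category.{v} C] {κ : Cardinal.{w}} [Fact κ.IsRegular]

lemma IsCardinalFiltered.of_exists_of_fullyFaithful {J : Type*} [Category* J] {K : Type*}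
    [Category* K] (F : J ⥤ K) [F.Full] [F.Faithful] [IsCardinalFiltered K κ]
    (h : ∀ k, ∃ j, Nonempty (k ⟶ F.obj j)) : IsCardinalFiltered J κ where
  nonempty_cocone G hA := by
    let c := IsCardinalFiltered.cocone (G ⋙ F) hA
    obtain ⟨j, ⟨f⟩⟩ := h c.pt
    exact ⟨{
      pt := j
      ι.app a := F.preimage (c.ι.app a ≫ f)
      ι.naturality a b g := F.map_injective (by simpa using c.w_assoc g f) }⟩

/-- If every morphism from a `κ`-presentable object to `X` factors through an object of a class `Q`
of `κ`-presentable objects, then `X` is a `κ`-filtered colimit of objects of `Q`. -/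
lemma exists_colimitsOfShape_of_forall_factors [IsCardinalAccessibleCategory C κ]
    {Q : ObjectProperty C} (hQ : Q ≤ isCardinalPresentable C κ) {X : C}
    (h : ∀ (A : C), IsCardinalPresentable A κ → ∀ f : A ⟶ X,
      ∃ (B : C) (_ : Q B) (g : A ⟶ B) (q : B ⟶ X), g ≫ q = f) :
    ∃ (J : Type w) (_ : SmallCategory J) (_ : IsCardinalFiltered J κ), Q.colimitsOfShape J X := by
  let D := CostructuredArrow (isCardinalPresentable C κ).ι X
  let R : ObjectProperty D := fun d ↦ Q d.left.obj
  have hR (d : D) : ∃ r, Nonempty (d ⟶ R.ι.obj r) := by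
    obtain ⟨B, hB, g, q, fac⟩ := h d.left.obj d.left.property d.hom
    let B' : (isCardinalPresentable C κ).FullSubcategory := ⟨B, hQ _ hB⟩
    let b : D := CostructuredArrow.mk (Y := B') (by exact q)
    let φ : d ⟶ b := CostructuredArrow.homMk (ObjectProperty.homMk g) (by exact fac)
    exact ⟨⟨b, hB⟩, ⟨φ⟩⟩
  have : IsCardinalFiltered R.FullSubcategory κ := .of_exists_of_fullyFaithful R.ι hR
  have : IsFiltered D := isFiltered_of_isCardinalFiltered _ κ
  have : R.ι.Final := Functor.final_of_exists_of_isFiltered_of_fullyFaithful _ hR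
  have : EssentiallySmall.{w} R.FullSubcategory := essentiallySmall_of_fully_faithful R.ι
  let e := equivSmallModel.{w} R.FullSubcategory
  exact ⟨SmallModel.{w} R.FullSubcategory, inferInstance, .of_equivalence κ e,
    ⟨{ diag := _
       ι := _
       isColimit := ((Functor.Final.isColimitWhiskerEquiv R.ι _).symm
         ((isCardinalPresentable C κ).ι.denseAt X)).whiskerEquivalence e.symm
       prop_diag_obj j := (e.inverse.obj j).property }⟩⟩

end Factorization

namespace Arrow

variable {M : Type u} [Category.{v} M] {κ : Cardinal.{v}} [Fact κ.IsRegular]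

/-- Morphisms from `𝟙 G` to an arrow `a` are morphisms from `G` to the source of `a`. -/
def homFromIdentity {G : M} {a : Arrow M} (f : G ⟶ a.left) : Arrow.mk (𝟙 G) ⟶ a :=
  Arrow.homMk f (f ≫ a.hom) (by simp)

lemma hom_fromIdentity_ext {G : M} {a : Arrow M} {f g : Arrow.mk (𝟙 G) ⟶ a}
    (h : f.left = g.left) : f = g :=
  Arrow.hom_ext _ _ h (by
    have hf := Arrow.w f
    have hg := Arrow.w g
    simp_all)

section HasColimits

variable [HasColimits M]

/-- The morphisms `∅ ⟶ G` and `𝟙 G` of `M`, for all objects `G` satisfying `P`. -/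
inductive initialOrIdentity (P : ObjectProperty M) : ObjectProperty (Arrow M)
  | fromInitial (G : M) (hG : P G) : initialOrIdentity P (Arrow.mk (initial.to G))
  | identity (G : M) (hG : P G) : initialOrIdentity P (Arrow.mk (𝟙 G))

instance (P : ObjectProperty M) [ObjectProperty.Small.{v} P] :
    ObjectProperty.Small.{v} (initialOrIdentity P) := by
  refine small_of_surjective (α := Subtype P ⊕ Subtype P)
    (f := Sum.elim (fun G ↦ ⟨_, .fromInitial G.1 G.2⟩) (fun G ↦ ⟨_, .identity G.1 G.2⟩)) ?_
  rintro ⟨_, ⟨G, hG⟩ | ⟨G, hG⟩⟩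
  · exact ⟨Sum.inl ⟨G, hG⟩, rfl⟩
  · exact ⟨Sum.inr ⟨G, hG⟩, rfl⟩

/-- Morphisms from `∅ ⟶ G` to an arrow `a` are morphisms from `G` to the target of `a`. -/
noncomputable def homFromInitial {G : M} {a : Arrow M} (f : G ⟶ a.right) :
    Arrow.mk (initial.to G) ⟶ a :=
  Arrow.homMk (initial.to _) f (initialIsInitial.hom_ext _ _)

lemma hom_fromInitial_ext {G : M} {a : Arrow M} {f g : Arrow.mk (initial.to G) ⟶ a}
    (h : f.right = g.right) : f = g :=
  Arrow.hom_ext _ _ (initialIsInitial.hom_ext _ _) h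

lemma isCardinalPresentable_fromInitial (G : M) [IsCardinalPresentable G κ] :
    IsCardinalPresentable (Arrow.mk (initial.to G)) κ := by
  let e : (Arrow.rightFunc : Arrow M ⥤ M) ⋙ coyoneda.obj (.op G) ≅
      coyoneda.obj (.op (Arrow.mk (initial.to G))) :=
    NatIso.ofComponents (fun a ↦ Equiv.toIso
      { toFun f := homFromInitial f
        invFun f := f.right
        left_inv _ := rfl
        right_inv _ := hom_fromInitial_ext rfl }) (fun _ ↦ by
          ext; exact hom_fromInitial_ext rfl)
  have : (Arrow.rightFunc : Arrow M ⥤ M).IsCardinalAccessible κ := ⟨fun _ _ _ ↦ inferInstance⟩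
  exact Functor.isCardinalAccessible_of_natIso e κ

lemma isCardinalPresentable_identity (G : M) [IsCardinalPresentable G κ] :
    IsCardinalPresentable (Arrow.mk (𝟙 G)) κ := by
  let e : (Arrow.leftFunc : Arrow M ⥤ M) ⋙ coyoneda.obj (.op G) ≅
      coyoneda.obj (.op (Arrow.mk (𝟙 G))) :=
    NatIso.ofComponents (fun a ↦ Equiv.toIso
      { toFun f := homFromIdentity f
        invFun f := f.left
        left_inv _ := rfl
        right_inv _ := hom_fromIdentity_ext rfl }) (fun _ ↦ by
          ext; exact hom_fromIdentity_ext rfl)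
  have : (Arrow.leftFunc : Arrow M ⥤ M).IsCardinalAccessible κ := ⟨fun _ _ _ ↦ inferInstance⟩
  exact Functor.isCardinalAccessible_of_natIso e κ

lemma initialOrIdentity_le_isCardinalPresentable {P : ObjectProperty M}
    (hP : P ≤ isCardinalPresentable M κ) :
    initialOrIdentity P ≤ isCardinalPresentable (Arrow M) κ := by
  rintro _ (⟨G, hG⟩ | ⟨G, hG⟩) <;> have : IsCardinalPresentable G κ := hP _ hG
  · exact isCardinalPresentable_fromInitial G
  · exact isCardinalPresentable_identity G

lemma isStrongGenerator_initialOrIdentity {P : ObjectProperty M} (hP : P.IsStrongGenerator) :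
    (initialOrIdentity P).IsStrongGenerator := by
  rw [ObjectProperty.isStrongGenerator_iff] at hP ⊢
  refine ⟨fun a b f g h ↦ ?_, fun a b i _ hi ↦ ?_⟩
  · refine Arrow.hom_ext _ _ (hP.1 _ _ fun G hG t ↦ ?_) (hP.1 _ _ fun G hG t ↦ ?_)
    · exact congr_arg CommaMorphism.left (h _ (.identity G hG) (homFromIdentity t))
    · exact congr_arg CommaMorphism.right (h _ (.fromInitial G hG) (homFromInitial t))
  · have : Mono i.left := ⟨fun s t h ↦ congr_arg CommaMorphism.left
      ((cancel_mono i).1 (hom_fromIdentity_ext h : homFromIdentity s ≫ i = homFromIdentity t ≫ i))⟩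
    have : Mono i.right := ⟨fun s t h ↦ congr_arg CommaMorphism.right
      ((cancel_mono i).1 (hom_fromInitial_ext h : homFromInitial s ≫ i = homFromInitial t ≫ i))⟩
    have : IsIso i.left := hP.2 _ fun G hG t ↦ by
      obtain ⟨s, hs⟩ := hi _ (.identity G hG) (homFromIdentity t)
      exact ⟨s.left, congr_arg CommaMorphism.left hs⟩
    have : IsIso i.right := hP.2 _ fun G hG t ↦ by
      obtain ⟨s, hs⟩ := hi _ (.fromInitial G hG) (homFromInitial t)
      exact ⟨s.right, congr_arg CommaMorphism.right hs⟩
    exact Arrow.isIso_of_isIso_left_of_isIso_right i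

lemma isCardinalPresentable_initial : IsCardinalPresentable (⊥_ M) κ := by
  have := isClosedUnderColimitsOfShape_isCardinalPresentable M (κ := κ)
    (J := Discrete PEmpty.{1}) (hasCardinalLT_of_finite _ κ (Cardinal.IsRegular.aleph0_le Fact.out))
  exact (isCardinalPresentable M κ).prop_of_isColimit (colimit.isColimit _) (by rintro ⟨⟨⟩⟩)

end HasColimits

variable (M κ) in
instance isCardinalLocallyPresentable [IsCardinalLocallyPresentable M κ] :
    IsCardinalLocallyPresentable (Arrow M) κ := by
  obtain ⟨P, _, hP₁, hP₂⟩ :=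
    (IsCardinalLocallyPresentable.iff_exists_isStrongGenerator M κ).1 inferInstance
  rw [IsCardinalLocallyPresentable.iff_exists_isStrongGenerator]
  exact ⟨initialOrIdentity P, inferInstance, isStrongGenerator_initialOrIdentity hP₁,
    initialOrIdentity_le_isCardinalPresentable hP₂⟩

/-- A `κ`-presentable arrow in a locally `κ`-presentable category has `κ`-presentable source
and target. -/
lemma isCardinalPresentable_left_and_right [IsCardinalLocallyPresentable M κ] (a : Arrow M)
    [ha : IsCardinalPresentable a κ] :
    IsCardinalPresentable a.left κ ∧ IsCardinalPresentable a.right κ := by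
  obtain ⟨P, _, hP₁, hP₂⟩ :=
    (IsCardinalLocallyPresentable.iff_exists_isStrongGenerator M κ).1 inferInstance
  rw [← isCardinalPresentable_iff,
    IsStrongGenerator.colimitsCardinalClosure_eq_isCardinalPresentable
      (isStrongGenerator_initialOrIdentity hP₁)
      (initialOrIdentity_le_isCardinalPresentable hP₂)] at ha
  let Q : ObjectProperty (Arrow M) := (isCardinalPresentable M κ).inverseImage Arrow.leftFunc ⊓
    (isCardinalPresentable M κ).inverseImage Arrow.rightFunc
  refine ObjectProperty.colimitsCardinalClosure_le (Q := Q) _ κ (fun J _ hJ ↦ ?_) ?_ _ ha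
  · have := isClosedUnderColimitsOfShape_isCardinalPresentable M hJ
    exact ⟨fun b ⟨p⟩ ↦
      ⟨ObjectProperty.prop_of_isColimit _
        (isColimitOfPreserves Arrow.leftFunc p.isColimit) fun j ↦ (p.prop_diag_obj j).1,
      ObjectProperty.prop_of_isColimit _
        (isColimitOfPreserves Arrow.rightFunc p.isColimit) fun j ↦ (p.prop_diag_obj j).2⟩⟩
  · rintro _ (⟨G, hG⟩ | ⟨G, hG⟩)
    · exact ⟨isCardinalPresentable_initial, hP₂ _ hG⟩
    · exact ⟨hP₂ _ hG, hP₂ _ hG⟩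

end Arrow

end CategoryTheory

namespace PaperAcc

section Comparison

variable {κ : Cardinal.{v}} [Fact κ.IsRegular]

lemma isCardinalFiltered_iff {J : Type v} [SmallCategory J] :
    IsCardinalFiltered J κ ↔ CategoryTheory.IsCardinalFiltered J κ :=
  ⟨fun h ↦ ⟨fun F hA ↦ h _ ((hasCardinalLT_iff_cardinal_mk_lt _ _).1 hA) F⟩,
    fun h _ _ hA F ↦ h.nonempty_cocone F ((hasCardinalLT_iff_cardinal_mk_lt _ _).2 hA)⟩

lemma isPresentable_iff {M : Type u} [Category.{v} M] {X : M} :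
    IsPresentable κ X ↔ IsCardinalPresentable X κ :=
  ⟨fun h ↦ ⟨fun J _ hJ ↦ (h J (isCardinalFiltered_iff.2 hJ)).some⟩,
    fun h J _ hJ ↦ by
      have := isCardinalFiltered_iff.1 hJ
      exact ⟨preservesColimitsOfShape_of_isCardinalPresentable X κ J⟩⟩

lemma IsLocallyPresentable.isCardinalLocallyPresentable {M : Type u} [Category.{v} M]
    (h : IsLocallyPresentable M κ) : IsCardinalLocallyPresentable M κ := by
  obtain ⟨_, ι, G, hG, hM⟩ := h
  have : (ObjectProperty.ofObj G).IsCardinalFilteredGenerator κ :=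
    { le_isCardinalPresentable := by
        rintro _ ⟨i⟩
        exact isPresentable_iff.1 (hG i)
      exists_colimitsOfShape X := by
        obtain ⟨J, hJ, F, mem, c, hc, e⟩ := hM X
        refine ⟨J, inferInstance, isCardinalFiltered_iff.1 hJ, ?_⟩
        refine ObjectProperty.prop_of_iso _ e ⟨{
          diag := F
          ι := c.ι
          isColimit := hc
          prop_diag_obj j := ?_ }⟩
        obtain ⟨i, hi⟩ := mem j
        rw [← hi]
        exact ⟨i⟩ }
  have := this.hasCardinalFilteredGenerator
  constructor

end Comparison

/-- Let `M` be a `κ`-combinatorial model category and `λ ≥ κ` a regular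
cardinal such that the replacement-by-fibration functor `Rfib : M^→ ⥤ M^→` (arising from the
(trivial cofibration, fibration)-factorization given by the small object argument, so that
there is a natural morphism `f ⟶ Rfib f` whose first component is a trivial cofibration and
whose second component is invertible, and `Rfib f` is a fibration) preserves `λ`-filtered
colimits and `λ`-presentable objects. Then every fibration in `M` is a `λ`-filtered colimit
in `M^→` of fibrations between `λ`-presentable objects. -/
theorem statement14 {M : Type u} [Category.{v} M] (κ lam : Cardinal.{v})
    (S : ModelStructure M) (hcomb : IsCombinatorial S κ)
    (hlam : lam.IsRegular) (hκlam : κ ≤ lam)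
    (Rfib : Arrow M ⥤ Arrow M) (η : 𝟭 (Arrow M) ⟶ Rfib)
    (hfact : ∀ a : Arrow M, S.Cof (η.app a).left ∧ S.W (η.app a).left ∧
      IsIso (η.app a).right ∧ S.Fib (Rfib.obj a).hom)
    (hcolim : ∀ (J : Type v) [SmallCategory J], IsCardinalFiltered J lam →
      Nonempty (PreservesColimitsOfShape J Rfib))
    (hpres : ∀ a : Arrow M, IsPresentable lam a → IsPresentable lam (Rfib.obj a))
    {X Y : M} (p : X ⟶ Y) (hp : S.Fib p) :
    Nonempty (FilteredColimitPresentation (M := Arrow M) lam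
      (PresentableArrowsIn lam {a : Arrow M | S.Fib a.hom}) (Arrow.mk p)) := by
  have : Fact lam.IsRegular := ⟨hlam⟩
  have : Fact κ.IsRegular := ⟨hcomb.isRegular⟩
  have := hcomb.locallyPresentable.isCardinalLocallyPresentable
  have := IsCardinalLocallyPresentable.of_le M hκlam
  have : HasColimits M := hcomb.locallyPresentable.1
  obtain ⟨r, hr⟩ : ∃ r : Rfib.obj (Arrow.mk p) ⟶ Arrow.mk p, η.app (Arrow.mk p) ≫ r = 𝟙 _ := by
    obtain ⟨hcof, hW, _, -⟩ := hfact (Arrow.mk p)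
    have := S.lift_trivCof_fib _ p hcof hW hp
    have sq : CommSq (𝟙 X) (η.app (Arrow.mk p)).left p
        ((Rfib.obj (Arrow.mk p)).hom ≫ inv (η.app (Arrow.mk p)).right) :=
      ⟨by simp⟩
    exact ⟨Arrow.homMk sq.lift (inv (η.app (Arrow.mk p)).right) sq.fac_right,
      Arrow.hom_ext _ _ sq.fac_left (IsIso.hom_inv_id _)⟩
  let Q : ObjectProperty (Arrow M) := fun a ↦ IsCardinalPresentable a lam ∧ S.Fib a.hom
  obtain ⟨J, _, hJ, ⟨pres⟩⟩ := exists_colimitsOfShape_of_forall_factors (κ := lam) (Q := Q)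
    (fun _ h ↦ h.1) (X := Arrow.mk p) fun A hA f ↦
      ⟨Rfib.obj A, ⟨isPresentable_iff.1 (hpres A (isPresentable_iff.2 hA)), (hfact A).2.2.2⟩,
        η.app A, Rfib.map f ≫ r, by rw [← η.naturality_assoc, hr]; simp⟩
  exact ⟨{
    J := J
    filtered := isCardinalFiltered_iff.2 hJ
    F := pres.diag
    mem j := by
      obtain ⟨_, hfib⟩ := pres.prop_diag_obj j
      obtain ⟨hl, hr⟩ := Arrow.isCardinalPresentable_left_and_right (κ := lam) (pres.diag.obj j)
      exact ⟨hfib, isPresentable_iff.2 hl, isPresentable_iff.2 hr⟩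
    c := pres.cocone
    isColimit := pres.isColimit
    iso := Iso.refl _ }⟩

end PaperAcc
end
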